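/- arXiv:1907.05802 — 5 statements merged into one kernel-verified Lean document; each statement's English description precedes it below -/
import Mathlib

section
/- For every θ ∈ (0, π), the Cesàro-type average of squared Legendre polynomials satisfies lim_{L→∞} (1/(L+1)) · Σ_{ℓ=0}^{L} (2ℓ+1) · P_ℓ(cos θ)² = 2/(π · sin θ). -/
open Real Filter Finset

/-- The `n`-th Legendre polynomial, defined via Rodrigues' formula
`P_n(t) = (1/(2^n n!)) (d/dt)^n (t^2 - 1)^n`. -/
noncomputable def legendreP (n : ℕ) : Polynomial ℝ :=
  ((2 ^ n * n.factorial : ℝ))⁻¹ •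
    ((fun q : Polynomial ℝ => Polynomial.derivative q)^[n] ((Polynomial.X ^ 2 - 1) ^ n))

section Rodrigues

open Polynomial

/-- The unnormalised Legendre polynomial of Rodrigues' formula. -/
noncomputable def rodriguesP (n : ℕ) : ℝ[X] :=
  derivative^[n] ((X ^ 2 - 1) ^ n)

theorem legendreP_eq_smul_rodriguesP (n : ℕ) :
    legendreP n = ((2 ^ n * n.factorial : ℝ))⁻¹ • rodriguesP n := rfl

theorem rodriguesP_succ_eq_iterate_derivative_mul_X (n : ℕ) :
    rodriguesP (n + 1) =
      2 * ((n : ℝ[X]) + 1) * (rodriguesP n * X + (n : ℝ[X]) * (derivative^[n - 1] ((X ^ 2 - 1) ^ n) : ℝ[X])) := by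
  have h : derivative ((X ^ 2 - 1 : ℝ[X]) ^ (n + 1)) =
      ((2 * (n + 1) : ℕ) : ℝ[X]) * ((X ^ 2 - 1) ^ n * X) := by
    rw [derivative_pow_succ]
    simp
    ring
  unfold rodriguesP
  rw [Function.iterate_succ_apply, h, iterate_derivative_natCast_mul, iterate_derivative_mul_X,
    nsmul_eq_mul]
  push_cast
  ring

theorem rodriguesP_succ_eq_iterate_derivative_mul_X_sq (n : ℕ) :
    rodriguesP (n + 1) =
      (X ^ 2 - 1) * derivative (rodriguesP n) + 2 * ((n : ℝ[X]) + 1) * (rodriguesP n * X) +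
        ((n : ℝ[X]) + 1) * (n : ℝ[X]) * (derivative^[n - 1] ((X ^ 2 - 1) ^ n) : ℝ[X]) := by
  have h : ((X ^ 2 - 1 : ℝ[X]) ^ (n + 1)) =
      (X ^ 2 - 1) ^ n * X * X - (X ^ 2 - 1) ^ n := by ring
  unfold rodriguesP
  rw [h, iterate_derivative_sub, iterate_derivative_mul_X, iterate_derivative_mul_X,
    Nat.add_sub_cancel, iterate_derivative_mul_X, Function.iterate_succ_apply']
  simp only [nsmul_eq_mul]
  push_cast
  ring

theorem rodriguesP_succ (n : ℕ) :
    rodriguesP (n + 1) =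
      2 * ((n : ℝ[X]) + 1) * (X * rodriguesP n) + 2 * (X ^ 2 - 1) * derivative (rodriguesP n) := by
  have h1 := rodriguesP_succ_eq_iterate_derivative_mul_X n
  have h2 := rodriguesP_succ_eq_iterate_derivative_mul_X_sq n
  linear_combination 2 * h2 - h1

theorem derivative_rodriguesP_succ (n : ℕ) :
    derivative (rodriguesP (n + 1)) =
      2 * ((n : ℝ[X]) + 1) * (((n : ℝ[X]) + 1) * rodriguesP n + X * derivative (rodriguesP n)) := by
  have h : (n : ℝ[X]) * derivative ((derivative^[n - 1] ((X ^ 2 - 1) ^ n) : ℝ[X])) = n * rodriguesP n := by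
    rcases n with _ | n
    · simp
    · rw [Nat.add_sub_cancel, ← Function.iterate_succ_apply' derivative n, rodriguesP]
  rw [rodriguesP_succ_eq_iterate_derivative_mul_X]
  simp only [derivative_mul, derivative_add, derivative_natCast, derivative_one, derivative_X,
    derivative_ofNat]
  linear_combination 2 * ((n : ℝ[X]) + 1) * h

theorem legendreP_zero : legendreP 0 = 1 := by
  simp [legendreP]

theorem legendreP_succ_eval (n : ℕ) (x : ℝ) :
    ((n : ℝ) + 1) * (legendreP (n + 1)).eval x =
      ((n : ℝ) + 1) * (x * (legendreP n).eval x) +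
        (x ^ 2 - 1) * (derivative (legendreP n)).eval x := by
  rw [legendreP_eq_smul_rodriguesP, legendreP_eq_smul_rodriguesP, rodriguesP_succ]
  simp [Nat.factorial_succ, pow_succ]
  field_simp

theorem derivative_legendreP_succ_eval (n : ℕ) (x : ℝ) :
    (derivative (legendreP (n + 1))).eval x =
      ((n : ℝ) + 1) * (legendreP n).eval x + x * (derivative (legendreP n)).eval x := by
  rw [legendreP_eq_smul_rodriguesP, legendreP_eq_smul_rodriguesP, derivative_smul,
    derivative_rodriguesP_succ]
  simp [Nat.factorial_succ, pow_succ]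
  field_simp

theorem legendreP_one_eval (x : ℝ) : (legendreP 1).eval x = x := by
  simpa [legendreP_zero] using legendreP_succ_eval 0 x

/-- Bonnet's three-term recurrence. -/
theorem legendreP_add_two_eval (n : ℕ) (x : ℝ) :
    ((n : ℝ) + 2) * (legendreP (n + 2)).eval x =
      (2 * n + 3) * (x * (legendreP (n + 1)).eval x) - (n + 1) * (legendreP n).eval x := by
  have h1 := legendreP_succ_eval (n + 1) x
  have h2 := derivative_legendreP_succ_eval n x
  have h3 := legendreP_succ_eval n x
  push_cast at h1
  linear_combination h1 + (x ^ 2 - 1) * h2 - x * h3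

theorem legendreP_eval_one (n : ℕ) : (legendreP n).eval 1 = 1 := by
  induction n with
  | zero => simp [legendreP_zero]
  | succ n ih =>
    have h := legendreP_succ_eval n 1
    have : (n : ℝ) + 1 ≠ 0 := by positivity
    apply mul_left_cancel₀ this
    rw [h, ih]
    ring

/-- The Christoffel–Darboux formula on the diagonal. -/
theorem sum_sq_legendreP_eval (L : ℕ) (x : ℝ) :
    (1 - x ^ 2) * ∑ ℓ ∈ Finset.range (L + 1), (2 * (ℓ : ℝ) + 1) * ((legendreP ℓ).eval x) ^ 2 =
      ((L : ℝ) + 1) ^ 2 * ((legendreP L).eval x ^ 2 -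
        2 * x * (legendreP L).eval x * (legendreP (L + 1)).eval x +
        (legendreP (L + 1)).eval x ^ 2) := by
  induction L with
  | zero => simp [legendreP_zero, legendreP_one_eval]; ring
  | succ L ih =>
    rw [Finset.sum_range_succ, mul_add, ih]
    have h := legendreP_add_two_eval L x
    push_cast
    have h' : (legendreP (L + 2)).eval x = ((2 * L + 3) * (x * (legendreP (L + 1)).eval x) -
        (L + 1) * (legendreP L).eval x) / (L + 2) := by
      rw [← h]; field_simp
    rw [h']
    field_simp
    ring

end Rodrigues

section CentralBinomial

/-- The Taylor coefficients `binom(2k, k) / 4 ^ k` of `(1 - z) ^ (-1/2)`. -/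
noncomputable def invSqrtCoeff (k : ℕ) : ℝ := (k.centralBinom : ℝ) / 4 ^ k

theorem invSqrtCoeff_zero : invSqrtCoeff 0 = 1 := by simp [invSqrtCoeff]

theorem invSqrtCoeff_pos (k : ℕ) : 0 < invSqrtCoeff k := by
  have := Nat.centralBinom_pos k
  unfold invSqrtCoeff
  positivity

theorem invSqrtCoeff_succ (k : ℕ) :
    2 * ((k : ℝ) + 1) * invSqrtCoeff (k + 1) = (2 * k + 1) * invSqrtCoeff k := by
  have h : ((k : ℝ) + 1) * (k + 1).centralBinom = 2 * (2 * k + 1) * k.centralBinom := by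
    exact_mod_cast Nat.succ_mul_centralBinom_succ k
  unfold invSqrtCoeff
  field_simp
  rw [pow_succ]
  linear_combination 2 * 4 ^ k * h

theorem invSqrtCoeff_sq_mul (k : ℕ) :
    invSqrtCoeff k ^ 2 * (2 * k + 1) = (Real.Wallis.W k)⁻¹ := by
  induction k with
  | zero => simp [invSqrtCoeff_zero, Real.Wallis.W]
  | succ k ih =>
    have h : invSqrtCoeff (k + 1) = (2 * k + 1) * invSqrtCoeff k / (2 * ((k : ℝ) + 1)) := by
      rw [← invSqrtCoeff_succ]; field_simp
    rw [Real.Wallis.W_succ, mul_inv, ← ih, h]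
    push_cast
    field_simp
    ring

theorem one_le_wallis (k : ℕ) : 1 ≤ Real.Wallis.W k := by
  induction k with
  | zero => simp [Real.Wallis.W]
  | succ k ih =>
    rw [Real.Wallis.W_succ]
    refine one_le_mul_of_one_le_of_one_le ih ?_
    rw [div_mul_div_comm, one_le_div (by positivity)]
    nlinarith

theorem invSqrtCoeff_sq_mul_le_one (k : ℕ) : invSqrtCoeff k ^ 2 * (2 * k + 1) ≤ 1 := by
  rw [invSqrtCoeff_sq_mul]
  exact inv_le_one_of_one_le₀ (one_le_wallis k)

theorem sqrt_mul_invSqrtCoeff_le_one {x : ℝ} {k : ℕ} (hx : x ≤ 2 * k + 1) :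
    √x * invSqrtCoeff k ≤ 1 := by
  rcases le_total x 0 with h0 | h0
  · simp [Real.sqrt_eq_zero_of_nonpos h0]
  · refine (sq_le_one_iff₀ (mul_nonneg (Real.sqrt_nonneg x) (invSqrtCoeff_pos k).le)).1 ?_
    rw [mul_pow, Real.sq_sqrt h0, mul_comm]
    exact (mul_le_mul_of_nonneg_left hx (sq_nonneg _)).trans (invSqrtCoeff_sq_mul_le_one k)

theorem tendsto_invSqrtCoeff_sq_mul :
    Tendsto (fun k : ℕ => invSqrtCoeff k ^ 2 * (2 * k + 1)) atTop (nhds (2 / π)) := by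
  simp_rw [invSqrtCoeff_sq_mul]
  simpa using Real.Wallis.tendsto_W_nhds_pi_div_two.inv₀ (by positivity)

theorem tendsto_sqrt_mul_invSqrtCoeff (k : ℕ) :
    Tendsto (fun N : ℕ => √N * invSqrtCoeff (N - k)) atTop (nhds √(1 / π)) := by
  rw [← tendsto_add_atTop_iff_nat k]
  have h1 : Tendsto (fun N : ℕ => ((k : ℝ) + 1 * N) / (1 + 2 * N)) atTop (nhds (1 / 2)) :=
    tendsto_add_mul_div_add_mul_atTop_nhds _ _ _ two_ne_zero
  have h2 := (h1.mul tendsto_invSqrtCoeff_sq_mul).sqrt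
  rw [show (1 / 2 : ℝ) * (2 / π) = 1 / π by ring] at h2
  refine h2.congr fun N => ?_
  rw [Nat.add_sub_cancel, ← Real.sqrt_sq (invSqrtCoeff_pos N).le, ← Real.sqrt_mul (by positivity),
    Real.sqrt_sq (invSqrtCoeff_pos N).le]
  congr 1
  push_cast
  field_simp
  ring

theorem tendsto_invSqrtCoeff : Tendsto invSqrtCoeff atTop (nhds 0) := by
  have h := (tendsto_sqrt_mul_invSqrtCoeff 0).div_atTop
    (Real.tendsto_sqrt_atTop.comp tendsto_natCast_atTop_atTop)
  refine h.congr' ?_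
  filter_upwards [eventually_gt_atTop 0] with N hN
  have : √(N : ℝ) ≠ 0 := by positivity
  simp only [Function.comp_apply, Nat.sub_zero]
  field_simp

end CentralBinomial

section Expansion

open Polynomial

theorem hasDerivAt_cexp_two_mul_pow (k : ℕ) (θ : ℝ) :
    HasDerivAt (fun t : ℝ => Complex.exp (2 * t * Complex.I) ^ k)
      (2 * k * Complex.I * Complex.exp (2 * θ * Complex.I) ^ k) θ := by
  have h : HasDerivAt (fun t : ℝ => Complex.exp (k * (2 * t * Complex.I)))
      (Complex.exp (k * (2 * θ * Complex.I)) * (k * (2 * 1 * Complex.I))) θ :=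
    ((((Complex.ofRealCLM.hasDerivAt (x := θ)).const_mul 2).mul_const _).const_mul _).cexp
  simp_rw [← Complex.exp_nat_mul]
  convert h using 1
  ring

theorem legendreP_cos_succ (n : ℕ) {g' : ℂ} (θ : ℝ)
    (hg : HasDerivAt (fun t : ℝ => (((legendreP n).eval (Real.cos t) : ℝ) : ℂ) *
      Complex.exp (t * Complex.I) ^ n) g' θ) :
    ((n : ℂ) + 1) * ((((legendreP (n + 1)).eval (Real.cos θ) : ℝ) : ℂ) *
        Complex.exp (θ * Complex.I) ^ (n + 1)) =
      (2 * n + 1 + Complex.exp (2 * θ * Complex.I)) / 2 *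
        ((((legendreP n).eval (Real.cos θ) : ℝ) : ℂ) * Complex.exp (θ * Complex.I) ^ n) +
      (Complex.exp (2 * θ * Complex.I) - 1) / (2 * Complex.I) * g' := by
  have hP : HasDerivAt (fun t : ℝ => (((legendreP n).eval (Real.cos t) : ℝ) : ℂ))
      (((derivative (legendreP n)).eval (Real.cos θ) * (-Real.sin θ) : ℝ) : ℂ) θ :=
    (((legendreP n).hasDerivAt _).comp θ (Real.hasDerivAt_cos θ)).ofReal_comp
  have hE : HasDerivAt (fun t : ℝ => Complex.exp (t * Complex.I) ^ n)
      (n * Complex.I * Complex.exp (θ * Complex.I) ^ n) θ := by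
    have h : HasDerivAt (fun t : ℝ => Complex.exp (n * (t * Complex.I)))
        (Complex.exp (n * (θ * Complex.I)) * (n * (1 * Complex.I))) θ :=
      (((Complex.ofRealCLM.hasDerivAt (x := θ)).mul_const _).const_mul _).cexp
    simp_rw [← Complex.exp_nat_mul]
    convert h using 1
    ring
  rw [hg.unique (hP.mul hE)]
  have hrec : ((n : ℂ) + 1) * (((legendreP (n + 1)).eval (Real.cos θ) : ℝ) : ℂ) =
      ((n : ℂ) + 1) * ((Real.cos θ : ℂ) * (((legendreP n).eval (Real.cos θ) : ℝ) : ℂ)) +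
        (-(Real.sin θ : ℂ) ^ 2) * (((derivative (legendreP n)).eval (Real.cos θ) : ℝ) : ℂ) := by
    have h := legendreP_succ_eval n (Real.cos θ)
    rw [show Real.cos θ ^ 2 - 1 = -Real.sin θ ^ 2 by linarith [Real.sin_sq_add_cos_sq θ]] at h
    exact_mod_cast h
  have hE1 : Complex.exp (θ * Complex.I) = Real.cos θ + Real.sin θ * Complex.I := by
    rw [Complex.exp_mul_I]; simp
  have hE2 : Complex.exp (2 * θ * Complex.I) = Complex.exp (θ * Complex.I) ^ 2 := by
    rw [← Complex.exp_nat_mul]; congr 1; push_cast; ring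
  have hsc : (Real.cos θ : ℂ) ^ 2 = 1 - (Real.sin θ : ℂ) ^ 2 := by
    have := Real.cos_sq' θ
    exact_mod_cast this
  rw [pow_succ, hE2]
  push_cast at hrec hsc hE1 ⊢
  generalize Complex.exp (θ * Complex.I) ^ n = F
  rw [hE1]
  generalize (((legendreP n).eval (Real.cos θ) : ℝ) : ℂ) = p at *
  generalize (((derivative (legendreP n)).eval (Real.cos θ) : ℝ) : ℂ) = p' at *
  generalize Complex.cos θ = c at *
  generalize Complex.sin θ = s at *
  set E : ℂ := c + s * Complex.I with hEdef
  have hI := Complex.I_sq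
  have h1 : (1 + E ^ 2) / 2 = c * E := by
    linear_combination (s ^ 2 / 2) * hI - hsc / 2 + (E + c + s * Complex.I) / 2 * hEdef - c * hEdef
  have h2 : (E ^ 2 - 1) / (2 * Complex.I) = s * E := by
    rw [div_eq_iff (mul_ne_zero two_ne_zero Complex.I_ne_zero)]
    linear_combination hsc - s ^ 2 * hI
  have h3 : 1 + s * Complex.I * E = c * E := by
    linear_combination s ^ 2 * hI - hsc
  rw [h2]
  linear_combination F * E * hrec - p * F * h1 - n * p * F * h3

/-- The Fourier expansion of `P_n(cos θ)`. -/
theorem legendreP_cos_mul_exp (n : ℕ) (θ : ℝ) :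
    (((legendreP n).eval (Real.cos θ) : ℝ) : ℂ) * Complex.exp (θ * Complex.I) ^ n =
      ∑ k ∈ Finset.range (n + 1), (invSqrtCoeff k : ℂ) * invSqrtCoeff (n - k) *
        Complex.exp (2 * θ * Complex.I) ^ k := by
  induction n generalizing θ with
  | zero => simp [legendreP_zero, invSqrtCoeff_zero]
  | succ n ih =>
    have hg : HasDerivAt (fun t : ℝ => (((legendreP n).eval (Real.cos t) : ℝ) : ℂ) *
        Complex.exp (t * Complex.I) ^ n)
        (∑ k ∈ Finset.range (n + 1), (invSqrtCoeff k : ℂ) * invSqrtCoeff (n - k) *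
          (2 * k * Complex.I * Complex.exp (2 * θ * Complex.I) ^ k)) θ := by
      simp_rw [ih]
      exact HasDerivAt.fun_sum fun k _ => (hasDerivAt_cexp_two_mul_pow k θ).const_mul _
    have hn : (n : ℂ) + 1 ≠ 0 := by exact_mod_cast n.succ_ne_zero
    apply mul_left_cancel₀ hn
    rw [legendreP_cos_succ n θ hg, ih]
    generalize Complex.exp (2 * θ * Complex.I) = w
    have hsucc (k : ℕ) : 2 * ((k : ℂ) + 1) * invSqrtCoeff (k + 1) =
        (2 * k + 1) * invSqrtCoeff k := by exact_mod_cast invSqrtCoeff_succ k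
    have hsplit : ((n : ℂ) + 1) * ∑ k ∈ Finset.range (n + 1 + 1),
          (invSqrtCoeff k : ℂ) * invSqrtCoeff (n + 1 - k) * w ^ k =
        ∑ k ∈ Finset.range (n + 1 + 1),
          (k : ℂ) * (invSqrtCoeff k * invSqrtCoeff (n + 1 - k) * w ^ k) +
        ∑ k ∈ Finset.range (n + 1 + 1),
          ((n : ℂ) + 1 - k) * (invSqrtCoeff k * invSqrtCoeff (n + 1 - k) * w ^ k) := by
      rw [Finset.mul_sum, ← Finset.sum_add_distrib]
      exact Finset.sum_congr rfl fun k _ => by ring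
    rw [hsplit, Finset.sum_range_succ' _ (n + 1),
      Finset.sum_range_succ (fun k : ℕ => ((n : ℂ) + 1 - k) * _) (n + 1), Finset.mul_sum,
      Finset.mul_sum, ← Finset.sum_add_distrib]
    simp only [Nat.cast_zero, zero_mul, add_zero, Nat.cast_add, Nat.cast_one, sub_self,
      ← Finset.sum_add_distrib]
    refine Finset.sum_congr rfl fun k hk => ?_
    obtain ⟨m, rfl⟩ := Nat.exists_eq_add_of_le (Finset.mem_range_succ_iff.1 hk)
    rw [show k + m + 1 - k = m + 1 by lia, show k + m + 1 - (k + 1) = m by lia,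
      show k + m - k = m by lia]
    push_cast
    have h1 := hsucc k
    have h2 := hsucc m
    have hI : Complex.I ≠ 0 := Complex.I_ne_zero
    field_simp
    linear_combination (-(invSqrtCoeff m : ℂ) * w ^ k * w) * h1 -
      ((invSqrtCoeff k : ℂ) * w ^ k) * h2

theorem sum_invSqrtCoeff_mul (n : ℕ) :
    ∑ k ∈ Finset.range (n + 1), invSqrtCoeff k * invSqrtCoeff (n - k) = 1 := by
  have h := legendreP_cos_mul_exp n 0
  simp only [Real.cos_zero, legendreP_eval_one, Complex.ofReal_zero, mul_zero, zero_mul,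
    Complex.exp_zero, one_pow, mul_one, Complex.ofReal_one] at h
  exact_mod_cast h.symm

end Expansion

section SqrtSeries

/-- The Taylor coefficients of `(1 - z) ^ (1/2)`, as differences of those of `(1 - z) ^ (-1/2)`. -/
noncomputable def sqrtCoeff : ℕ → ℝ
  | 0 => 1
  | k + 1 => invSqrtCoeff (k + 1) - invSqrtCoeff k

theorem abs_sqrtCoeff_succ (k : ℕ) :
    |sqrtCoeff (k + 1)| = invSqrtCoeff k - invSqrtCoeff (k + 1) := by
  have h := invSqrtCoeff_succ k
  have hk := invSqrtCoeff_pos (k + 1)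
  have hk' := invSqrtCoeff_pos k
  rw [sqrtCoeff, abs_sub_comm, abs_of_nonneg]
  have : (0 : ℝ) ≤ k := k.cast_nonneg
  nlinarith

theorem abs_sqrtCoeff_succ_eq_div (k : ℕ) :
    |sqrtCoeff (k + 1)| = invSqrtCoeff k / (2 * ((k : ℝ) + 1)) := by
  rw [abs_sqrtCoeff_succ, eq_div_iff (by positivity)]
  linear_combination -invSqrtCoeff_succ k

theorem summable_abs_sqrtCoeff : Summable fun k => |sqrtCoeff k| := by
  rw [← summable_nat_add_iff 1]
  refine summable_of_sum_range_le (c := 1) (fun k => abs_nonneg _) fun n => ?_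
  simp_rw [abs_sqrtCoeff_succ]
  rw [Finset.sum_range_sub', invSqrtCoeff_zero]
  linarith [invSqrtCoeff_pos n]

theorem mk_sqrtCoeff_mul_self :
    PowerSeries.mk sqrtCoeff * PowerSeries.mk sqrtCoeff = 1 - PowerSeries.X := by
  have hA : PowerSeries.mk invSqrtCoeff * PowerSeries.mk invSqrtCoeff = PowerSeries.mk 1 := by
    ext n
    rw [PowerSeries.coeff_mul, Finset.Nat.sum_antidiagonal_eq_sum_range_succ_mk]
    simpa using sum_invSqrtCoeff_mul n
  have hB : PowerSeries.mk sqrtCoeff = (1 - PowerSeries.X) * PowerSeries.mk invSqrtCoeff := by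
    ext n
    rcases n with _ | n
    · simp [sqrtCoeff, invSqrtCoeff_zero]
    · simp [sub_mul, sqrtCoeff, PowerSeries.coeff_succ_X_mul]
  rw [hB]
  linear_combination (1 - PowerSeries.X) ^ 2 * hA +
    (1 - PowerSeries.X) * PowerSeries.mk_one_mul_one_sub_eq_one ℝ

theorem summable_norm_sqrtCoeff_mul_pow {w : ℂ} (hw : ‖w‖ = 1) :
    Summable fun k => ‖(sqrtCoeff k : ℂ) * w ^ k‖ := by
  simpa [hw] using summable_abs_sqrtCoeff

theorem tsum_sqrtCoeff_mul_pow_sq {w : ℂ} (hw : ‖w‖ = 1) :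
    (∑' k, (sqrtCoeff k : ℂ) * w ^ k) ^ 2 = 1 - w := by
  have hs := summable_norm_sqrtCoeff_mul_pow hw
  have hcoeff (n : ℕ) : ∑ kl ∈ antidiagonal n,
      ((sqrtCoeff kl.1 : ℂ) * w ^ kl.1) * (sqrtCoeff kl.2 * w ^ kl.2) =
        ((PowerSeries.coeff n (1 - PowerSeries.X : PowerSeries ℝ) : ℝ) : ℂ) * w ^ n := by
    rw [← mk_sqrtCoeff_mul_self, PowerSeries.coeff_mul]
    push_cast
    rw [Finset.sum_mul]
    refine Finset.sum_congr rfl fun kl hkl => ?_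
    rw [← mem_antidiagonal.1 hkl, pow_add]
    simp only [PowerSeries.coeff_mk]
    ring
  rw [sq, tsum_mul_tsum_eq_tsum_sum_antidiagonal_of_summable_norm hs hs]
  simp_rw [hcoeff]
  rw [tsum_eq_sum (s := Finset.range 2)]
  · simp [Finset.sum_range_succ, PowerSeries.coeff_one, PowerSeries.coeff_X]
    ring
  · intro n hn
    have h2 : 1 < n := by simpa using hn
    have h0 : n ≠ 0 := by lia
    have h1 : n ≠ 1 := by lia
    simp [PowerSeries.coeff_one, PowerSeries.coeff_X, h0, h1]

theorem sqrt_mul_abs_sqrtCoeff_mul_le_of_two_mul_le {N k : ℕ} (h : 2 * k ≤ N) :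
    √N * invSqrtCoeff (N - k) * |sqrtCoeff k| ≤ |sqrtCoeff k| := by
  refine mul_le_of_le_one_left (abs_nonneg _) (sqrt_mul_invSqrtCoeff_le_one ?_)
  have : N ≤ 2 * (N - k) + 1 := by lia
  exact_mod_cast this

theorem sqrt_mul_abs_sqrtCoeff_le_inv {N k : ℕ} (hN : 0 < N) (h : N < 2 * k) :
    √N * |sqrtCoeff k| ≤ (N : ℝ)⁻¹ := by
  obtain ⟨j, rfl⟩ : ∃ j, k = j + 1 := ⟨k - 1, by lia⟩
  have h1 : √(N : ℝ) * invSqrtCoeff j ≤ 1 :=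
    sqrt_mul_invSqrtCoeff_le_one (by exact_mod_cast (by lia : N ≤ 2 * j + 1))
  have h2 : (N : ℝ) ≤ 2 * (j + 1) := by exact_mod_cast h.le
  have hN' : (0 : ℝ) < N := by exact_mod_cast hN
  rw [abs_sqrtCoeff_succ_eq_div, ← mul_div_assoc, inv_eq_one_div]
  exact div_le_div₀ zero_le_one h1 hN' h2

/-- The low-order half of the convolution converges, by dominated convergence. -/
theorem tendsto_sum_sqrtCoeff_mul_low {w : ℂ} (hw : ‖w‖ = 1) :
    Tendsto (fun N : ℕ => ∑ k ∈ Finset.range (N + 1), if 2 * k ≤ N then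
        ((√N * invSqrtCoeff (N - k) : ℝ) : ℂ) * (sqrtCoeff k * w ^ k) else 0) atTop
      (nhds ((√(1 / π) : ℝ) * ∑' k, (sqrtCoeff k : ℂ) * w ^ k)) := by
  rw [← tsum_mul_left]
  have hmain := tendsto_tsum_of_dominated_convergence (𝓕 := atTop)
    (f := fun (N k : ℕ) => if 2 * k ≤ N then
      ((√N * invSqrtCoeff (N - k) : ℝ) : ℂ) * (sqrtCoeff k * w ^ k) else 0)
    (g := fun k => ((√(1 / π) : ℝ) : ℂ) * ((sqrtCoeff k : ℂ) * w ^ k))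
    summable_abs_sqrtCoeff (fun k => ?_) (Eventually.of_forall fun N k => ?_)
  · refine hmain.congr fun N => tsum_eq_sum fun k hk => if_neg ?_
    have : N + 1 ≤ k := by simpa using hk
    lia
  · have h := ((Complex.continuous_ofReal.tendsto _).comp
      (tendsto_sqrt_mul_invSqrtCoeff k)).mul_const ((sqrtCoeff k : ℂ) * w ^ k)
    refine h.congr' ?_
    filter_upwards [eventually_ge_atTop (2 * k)] with N hN
    simp [if_pos hN]
  · split_ifs with h
    · rw [norm_mul, norm_mul, norm_pow, hw, one_pow, mul_one, Complex.norm_real, Complex.norm_real,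
        Real.norm_eq_abs, Real.norm_eq_abs,
        abs_of_nonneg (mul_nonneg (Real.sqrt_nonneg _) (invSqrtCoeff_pos _).le)]
      exact sqrt_mul_abs_sqrtCoeff_mul_le_of_two_mul_le h
    · simp

/-- The high-order half of the convolution is negligible. -/
theorem tendsto_sum_sqrtCoeff_mul_high {w : ℂ} (hw : ‖w‖ = 1) :
    Tendsto (fun N : ℕ => ∑ k ∈ Finset.range (N + 1), if 2 * k ≤ N then 0 else
        ((√N * invSqrtCoeff (N - k) : ℝ) : ℂ) * (sqrtCoeff k * w ^ k)) atTop (nhds 0) := by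
  have hlim : Tendsto (fun N : ℕ => (N : ℝ)⁻¹ * ∑ j ∈ Finset.range (N + 1), invSqrtCoeff j)
      atTop (nhds 0) := by
    have h := tendsto_invSqrtCoeff.cesaro.add
      ((tendsto_inv_atTop_nhds_zero_nat (𝕜 := ℝ)).mul tendsto_invSqrtCoeff)
    simp_rw [← mul_add, ← Finset.sum_range_succ] at h
    simpa using h
  refine squeeze_zero_norm' ?_ hlim
  filter_upwards [eventually_gt_atTop 0] with N hN
  rw [← Finset.sum_range_reflect invSqrtCoeff, Finset.mul_sum]
  refine norm_sum_le_of_le _ fun k _ => ?_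
  rw [Nat.add_sub_cancel]
  have ha := (invSqrtCoeff_pos (N - k)).le
  split_ifs with h
  · rw [norm_zero]
    positivity
  · rw [norm_mul, norm_mul, norm_pow, hw, one_pow, mul_one, Complex.norm_real, Complex.norm_real,
      Real.norm_eq_abs, Real.norm_eq_abs, abs_of_nonneg (mul_nonneg (Real.sqrt_nonneg _) ha)]
    calc √(N : ℝ) * invSqrtCoeff (N - k) * |sqrtCoeff k|
        = √(N : ℝ) * |sqrtCoeff k| * invSqrtCoeff (N - k) := by ring
      _ ≤ (N : ℝ)⁻¹ * invSqrtCoeff (N - k) :=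
        mul_le_mul_of_nonneg_right (sqrt_mul_abs_sqrtCoeff_le_inv hN (not_le.1 h)) ha

theorem tendsto_sqrt_mul_sum_sqrtCoeff_mul {w : ℂ} (hw : ‖w‖ = 1) :
    Tendsto (fun N : ℕ => ((√N : ℝ) : ℂ) * ∑ k ∈ Finset.range (N + 1),
        (sqrtCoeff k : ℂ) * invSqrtCoeff (N - k) * w ^ k) atTop
      (nhds ((√(1 / π) : ℝ) * ∑' k, (sqrtCoeff k : ℂ) * w ^ k)) := by
  have h := (tendsto_sum_sqrtCoeff_mul_low hw).add (tendsto_sum_sqrtCoeff_mul_high hw)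
  rw [add_zero] at h
  refine h.congr fun N => ?_
  rw [← Finset.sum_add_distrib, Finset.mul_sum]
  refine Finset.sum_congr rfl fun k _ => ?_
  push_cast
  split_ifs <;> ring

end SqrtSeries

theorem sum_sqrtCoeff_mul_eq_legendreP_cos (n : ℕ) (θ : ℝ) :
    ∑ k ∈ Finset.range (n + 1 + 1), (sqrtCoeff k : ℂ) * invSqrtCoeff (n + 1 - k) *
        Complex.exp (2 * θ * Complex.I) ^ k =
      ((((legendreP (n + 1)).eval (Real.cos θ) : ℝ) : ℂ) -
        Complex.exp (θ * Complex.I) * (((legendreP n).eval (Real.cos θ) : ℝ) : ℂ)) *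
        Complex.exp (θ * Complex.I) ^ (n + 1) := by
  have hE2 : Complex.exp (2 * θ * Complex.I) = Complex.exp (θ * Complex.I) ^ 2 := by
    rw [← Complex.exp_nat_mul]; congr 1; push_cast; ring
  have h1 := legendreP_cos_mul_exp n θ
  have h2 := legendreP_cos_mul_exp (n + 1) θ
  have h3 : ∑ k ∈ Finset.range (n + 1 + 1), (sqrtCoeff k : ℂ) * invSqrtCoeff (n + 1 - k) *
        Complex.exp (2 * θ * Complex.I) ^ k =
      ∑ k ∈ Finset.range (n + 1 + 1), (invSqrtCoeff k : ℂ) * invSqrtCoeff (n + 1 - k) *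
        Complex.exp (2 * θ * Complex.I) ^ k -
      Complex.exp (2 * θ * Complex.I) * ∑ k ∈ Finset.range (n + 1),
        (invSqrtCoeff k : ℂ) * invSqrtCoeff (n - k) * Complex.exp (2 * θ * Complex.I) ^ k := by
    rw [Finset.sum_range_succ' _ (n + 1), Finset.sum_range_succ' _ (n + 1), Finset.mul_sum,
      add_sub_right_comm, ← Finset.sum_sub_distrib]
    congr 1
    · refine Finset.sum_congr rfl fun k _ => ?_
      rw [Nat.add_sub_add_right, sqrtCoeff]
      push_cast
      ring
    · simp [sqrtCoeff, invSqrtCoeff_zero]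
  rw [h3, ← h1, ← h2, hE2]
  ring

theorem norm_legendreP_cos_sub_sq (n : ℕ) (θ : ℝ) :
    ‖(((((legendreP (n + 1)).eval (Real.cos θ) : ℝ) : ℂ) -
        Complex.exp (θ * Complex.I) * (((legendreP n).eval (Real.cos θ) : ℝ) : ℂ)) *
        Complex.exp (θ * Complex.I) ^ (n + 1))‖ ^ 2 =
      (legendreP n).eval (Real.cos θ) ^ 2 -
        2 * Real.cos θ * (legendreP n).eval (Real.cos θ) * (legendreP (n + 1)).eval (Real.cos θ) +
        (legendreP (n + 1)).eval (Real.cos θ) ^ 2 := by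
  rw [norm_mul, norm_pow, Complex.norm_exp_ofReal_mul_I, one_pow, mul_one, Complex.sq_norm,
    Complex.normSq_apply]
  simp only [Complex.sub_re, Complex.sub_im, Complex.mul_re, Complex.mul_im, Complex.ofReal_re,
    Complex.ofReal_im, Complex.exp_ofReal_mul_I_re, Complex.exp_ofReal_mul_I_im]
  linear_combination (legendreP n).eval (Real.cos θ) ^ 2 * Real.sin_sq_add_cos_sq θ

theorem norm_one_sub_cexp_two_mul {θ : ℝ} (h : 0 ≤ Real.sin θ) :
    ‖1 - Complex.exp (2 * θ * Complex.I)‖ = 2 * Real.sin θ := by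
  have hE : 1 - Complex.exp (2 * θ * Complex.I) =
      Complex.exp (θ * Complex.I) * (((-2 * Real.sin θ : ℝ) : ℂ) * Complex.I) := by
    rw [show 2 * (θ : ℂ) * Complex.I = θ * Complex.I + θ * Complex.I by ring, Complex.exp_add,
      Complex.exp_mul_I]
    push_cast
    linear_combination Complex.sin θ ^ 2 * Complex.I_sq - Complex.sin_sq_add_cos_sq θ
  rw [hE, norm_mul, Complex.norm_exp_ofReal_mul_I, norm_mul, Complex.norm_real, Complex.norm_I,
    Real.norm_eq_abs, abs_of_nonpos (by linarith)]
  ring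

/-- For every `θ ∈ (0, π)`,
`lim_{L→∞} (1/(L+1)) ∑_{ℓ=0}^{L} (2ℓ+1) P_ℓ(cos θ)^2 = 2/(π sin θ)`. -/
theorem cesaro_squared_legendre (θ : ℝ) (hθ : θ ∈ Set.Ioo 0 π) :
    Tendsto (fun L : ℕ =>
        (1 / (L + 1 : ℝ)) * ∑ ℓ ∈ Finset.range (L + 1),
          (2 * (ℓ : ℝ) + 1) * ((legendreP ℓ).eval (Real.cos θ)) ^ 2)
      atTop (nhds (2 / (π * Real.sin θ))) := by
  have hsin : 0 < Real.sin θ := Real.sin_pos_of_pos_of_lt_pi hθ.1 hθ.2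
  have hw : ‖Complex.exp (2 * θ * Complex.I)‖ = 1 := by
    exact_mod_cast Complex.norm_exp_ofReal_mul_I (2 * θ)
  have h := ((tendsto_sqrt_mul_sum_sqrtCoeff_mul hw).norm.pow 2).comp (tendsto_add_atTop_nat 1)
  rw [norm_mul, mul_pow, ← norm_pow (tsum _), tsum_sqrtCoeff_mul_pow_sq hw,
    norm_one_sub_cexp_two_mul hsin.le, Complex.norm_real, Real.norm_eq_abs, sq_abs,
    Real.sq_sqrt (by positivity)] at h
  have hlim : 2 / (π * Real.sin θ) = 1 / π * (2 * Real.sin θ) / Real.sin θ ^ 2 := by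
    field_simp
  rw [hlim]
  refine (h.div_const (Real.sin θ ^ 2)).congr fun L => ?_
  have hsum := sum_sq_legendreP_eval L (Real.cos θ)
  rw [← Real.sin_sq] at hsum
  rw [Function.comp_apply, sum_sqrtCoeff_mul_eq_legendreP_cos, norm_mul, mul_pow,
    norm_legendreP_cos_sub_sq, Complex.norm_real, Real.norm_eq_abs, sq_abs,
    Real.sq_sqrt (by positivity)]
  push_cast
  field_simp
  linear_combination -hsum
end

section
/- For every θ ∈ (0, π) there exists a constant C > 0 such that for all integers ℓ ≥ 1, |(2ℓ+1) · P_ℓ(cos θ)² − (4/(π sin θ)) · sin²(ℓθ + θ/2 + π/4)| ≤ C/ℓ. -/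
open Real Filter Finset

/-! ### Legendre polynomials -/

section Polynomial

open Polynomial

/-- The differential equation satisfied by the derivatives of `(X ^ 2 - 1) ^ n`. -/
lemma iterate_derivative_sq_sub_one_pow_ode (n k : ℕ) :
    (X ^ 2 - 1 : ℝ[X]) * derivative (derivative (derivative^[k] ((X ^ 2 - 1) ^ n)))
      + C (2 * (k + 1) - 2 * n : ℝ) * X * derivative (derivative^[k] ((X ^ 2 - 1) ^ n))
      + C ((k + 1) * (k - 2 * n) : ℝ) * derivative^[k] ((X ^ 2 - 1) ^ n) = 0 := by
  have hC : (C 2 : ℝ[X]) = 2 := map_ofNat C 2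
  induction k with
  | zero =>
    have h : (X ^ 2 - 1 : ℝ[X]) * derivative ((X ^ 2 - 1) ^ n)
        = C (2 * n : ℝ) * X * (X ^ 2 - 1) ^ n := by
      rcases n with _ | n
      · simp
      · simp only [derivative_pow, derivative_sub, derivative_one, map_mul,
          Nat.add_sub_cancel, map_natCast]
        simp [hC]
        ring
    have h' := congrArg derivative h
    simp only [derivative_mul, derivative_sub, derivative_X_pow, derivative_one, derivative_C,
      derivative_X] at h'
    simp only [Function.iterate_zero, id]
    simp [hC] at h' ⊢
    linear_combination h'
  | succ k ih =>
    have h' := congrArg derivative ih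
    simp only [derivative_mul, derivative_add, derivative_sub, derivative_X_pow, derivative_one,
      derivative_C, derivative_X] at h'
    simp only [Function.iterate_succ_apply']
    simp [hC] at h' ⊢
    linear_combination h'

lemma legendreP_ode (n : ℕ) (x : ℝ) :
    (1 - x ^ 2) * (derivative (derivative (legendreP n))).eval x
      - 2 * x * (derivative (legendreP n)).eval x
      + n * (n + 1) * (legendreP n).eval x = 0 := by
  have h := congrArg (eval x) (iterate_derivative_sq_sub_one_pow_ode n n)
  simp only [eval_add, eval_mul, eval_sub, eval_pow, eval_X, eval_one, eval_C, eval_zero] at h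
  have e : legendreP n = ((2 ^ n * n.factorial : ℝ))⁻¹ • derivative^[n] ((X ^ 2 - 1) ^ n) := rfl
  simp only [e, derivative_smul, eval_smul, smul_eq_mul]
  linear_combination (-((2 ^ n * n.factorial : ℝ))⁻¹) * h

lemma coeff_sq_sub_one_pow_two_mul (n k : ℕ) :
    ((X ^ 2 - 1 : ℝ[X]) ^ n).coeff (2 * k) = (-1) ^ (n - k) * n.choose k := by
  have h : (X ^ 2 - 1 : ℝ[X]) ^ n = expand ℝ 2 ((X + C (-1)) ^ n) := by
    simp [sub_eq_add_neg]
  rw [h, mul_comm 2 k, coeff_expand_mul two_pos, coeff_X_add_C_pow]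

lemma coeff_sq_sub_one_pow_two_mul_add_one (n k : ℕ) :
    ((X ^ 2 - 1 : ℝ[X]) ^ n).coeff (2 * k + 1) = 0 := by
  have h : (X ^ 2 - 1 : ℝ[X]) ^ n = expand ℝ 2 ((X + C (-1)) ^ n) := by
    simp [sub_eq_add_neg]
  rw [h, coeff_expand two_pos, if_neg (by omega)]

lemma legendreP_eval_zero (n : ℕ) :
    (legendreP n).eval 0 = (2 ^ n)⁻¹ * ((X ^ 2 - 1 : ℝ[X]) ^ n).coeff n := by
  have e : legendreP n = ((2 ^ n * n.factorial : ℝ))⁻¹ • derivative^[n] ((X ^ 2 - 1) ^ n) := rfl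
  have := n.factorial_ne_zero
  rw [← coeff_zero_eq_eval_zero, e, coeff_smul, coeff_iterate_derivative]
  simp only [zero_add, Nat.descFactorial_self, nsmul_eq_mul, smul_eq_mul]
  field_simp

lemma derivative_legendreP_eval_zero (n : ℕ) :
    (derivative (legendreP n)).eval 0
      = (2 ^ n)⁻¹ * (n + 1) * ((X ^ 2 - 1 : ℝ[X]) ^ n).coeff (n + 1) := by
  have e : legendreP n = ((2 ^ n * n.factorial : ℝ))⁻¹ • derivative^[n] ((X ^ 2 - 1) ^ n) := rfl
  have := n.factorial_ne_zero
  rw [← coeff_zero_eq_eval_zero, e, derivative_smul, ← Function.iterate_succ_apply' (⇑derivative),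
    coeff_smul, coeff_iterate_derivative]
  simp only [zero_add, Nat.descFactorial_self, nsmul_eq_mul, smul_eq_mul, Nat.factorial_succ]
  push_cast
  field_simp

lemma legendreP_odd_eval_zero (m : ℕ) : (legendreP (2 * m + 1)).eval 0 = 0 := by
  rw [legendreP_eval_zero, coeff_sq_sub_one_pow_two_mul_add_one, mul_zero]

lemma derivative_legendreP_even_eval_zero (m : ℕ) :
    (derivative (legendreP (2 * m))).eval 0 = 0 := by
  rw [derivative_legendreP_eval_zero, coeff_sq_sub_one_pow_two_mul_add_one, mul_zero]

lemma centralBinom_sq_mul_wallis (m : ℕ) :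
    ((m.centralBinom : ℝ) / 4 ^ m) ^ 2 * ((2 * m + 1) * Wallis.W m) = 1 := by
  induction m with
  | zero => simp [Wallis.W]
  | succ m ih =>
    have h : ((m : ℝ) + 1) * (m + 1).centralBinom = 2 * (2 * m + 1) * m.centralBinom := by
      exact_mod_cast m.succ_mul_centralBinom_succ
    have h' : ((m + 1).centralBinom : ℝ) = 2 * (2 * m + 1) * m.centralBinom / (m + 1) := by
      field_simp
      linarith
    rw [Wallis.W_succ, h']
    refine Eq.trans ?_ ih
    push_cast
    field_simp
    ring

lemma legendreP_even_eval_zero_sq (m : ℕ) :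
    (legendreP (2 * m)).eval 0 ^ 2 * ((2 * m + 1) * Wallis.W m) = 1 := by
  refine Eq.trans ?_ (centralBinom_sq_mul_wallis m)
  rw [legendreP_eval_zero, coeff_sq_sub_one_pow_two_mul,
    ← Nat.centralBinom_eq_two_mul_choose, pow_mul, show 2 * m - m = m by omega]
  have hs : ((-1 : ℝ) ^ m) ^ 2 = 1 := by rw [← pow_mul, mul_comm, pow_mul]; norm_num
  congr 1
  rw [mul_pow, mul_pow, hs]
  norm_num
  ring

lemma derivative_legendreP_odd_eval_zero_sq (m : ℕ) :
    (derivative (legendreP (2 * m + 1))).eval 0 ^ 2 * Wallis.W m = 2 * m + 1 := by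
  have h : ((m : ℝ) + 1) * (2 * m + 1).choose (m + 1) = (2 * m + 1) * m.centralBinom := by
    have := Nat.add_one_mul_choose_eq (2 * m) m
    rw [← Nat.centralBinom_eq_two_mul_choose] at this
    have h2 : ((2 * m + 1 : ℕ) : ℝ) * m.centralBinom
      = ((2 * m + 1).choose (m + 1) : ℕ) * ((m + 1 : ℕ) : ℝ) := by exact_mod_cast this
    push_cast at h2
    linarith
  have hP : (derivative (legendreP (2 * m + 1))).eval 0
      = (-1) ^ m * ((2 * m + 1) * (m.centralBinom / 4 ^ m)) := by
    rw [derivative_legendreP_eval_zero, show 2 * m + 1 + 1 = 2 * (m + 1) by ring,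
      coeff_sq_sub_one_pow_two_mul, show 2 * m + 1 - (m + 1) = m by omega, pow_succ, pow_mul,
      mul_div_assoc', ← h]
    push_cast
    norm_num
    field_simp
    ring
  have hs : ((-1 : ℝ) ^ m) ^ 2 = 1 := by rw [← pow_mul, mul_comm, pow_mul]; norm_num
  rw [hP, mul_pow, hs]
  linear_combination (2 * m + 1 : ℝ) * centralBinom_sq_mul_wallis m

end Polynomial

/-! ### Perturbations of the harmonic oscillator -/

/-- Grönwall's inequality for a differential inequality in both time directions. -/
lemma le_mul_exp_of_abs_deriv_le {f f' : ℝ → ℝ} {a b K : ℝ}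
    (hf : ∀ t ∈ Set.uIcc a b, HasDerivAt f (f' t) t)
    (hK : ∀ t ∈ Set.uIcc a b, |f' t| ≤ K * f t) :
    f b ≤ f a * exp (K * |b - a|) := by
  have hmem : ∀ s ∈ Set.Icc (0 : ℝ) 1, a + s * (b - a) ∈ Set.uIcc a b := by
    intro s hs
    rw [← segment_eq_uIcc, segment_eq_image']
    exact ⟨s, hs, by simp⟩
  have hd : ∀ s ∈ Set.Icc (0 : ℝ) 1,
      HasDerivAt (fun s => f (a + s * (b - a)) * exp (-(K * |b - a|) * s))
        (f' (a + s * (b - a)) * (b - a) * exp (-(K * |b - a|) * s)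
          + f (a + s * (b - a)) * (exp (-(K * |b - a|) * s) * -(K * |b - a|))) s := by
    intro s hs
    have h1 : HasDerivAt (fun s : ℝ => a + s * (b - a)) (b - a) s := by
      simpa using ((hasDerivAt_id s).mul_const (b - a)).const_add a
    have h2 : HasDerivAt (fun s : ℝ => -(K * |b - a|) * s) (-(K * |b - a|)) s := by
      simpa using (hasDerivAt_id s).const_mul (-(K * |b - a|))
    exact ((hf _ (hmem s hs)).comp s h1).mul h2.exp
  have hanti : AntitoneOn (fun s => f (a + s * (b - a)) * exp (-(K * |b - a|) * s))
      (Set.Icc 0 1) := by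
    refine antitoneOn_of_deriv_nonpos (convex_Icc 0 1)
      (fun s hs => (hd s hs).continuousAt.continuousWithinAt)
      (fun s hs => (hd s (interior_subset hs)).differentiableAt.differentiableWithinAt)
      fun s hs => ?_
    replace hs := interior_subset hs
    rw [(hd s hs).deriv]
    have h1 : f' (a + s * (b - a)) * (b - a) ≤ K * f (a + s * (b - a)) * |b - a| :=
      (le_abs_self _).trans <| by
        rw [abs_mul]
        exact mul_le_mul_of_nonneg_right (hK _ (hmem s hs)) (abs_nonneg _)
    nlinarith [mul_le_mul_of_nonneg_right h1 (exp_pos (-(K * |b - a|) * s)).le]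
  have h := hanti (Set.left_mem_Icc.2 zero_le_one) (Set.right_mem_Icc.2 zero_le_one) zero_le_one
  simp only [one_mul, add_sub_cancel, zero_mul, add_zero, mul_zero, exp_zero, mul_one] at h
  rwa [exp_neg, ← div_eq_mul_inv, div_le_iff₀ (exp_pos _)] at h

/-- A solution of `u'' + (N ^ 2 + q) u = 0` stays close to the solution of `w'' + N ^ 2 w = 0`
with the same initial data. -/
lemma abs_sq_sub_sq_oscillator_le {u v q : ℝ → ℝ} {a b N Q : ℝ} (hN : 1 ≤ N)
    (hu : ∀ t ∈ Set.uIcc a b, HasDerivAt u (v t) t)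
    (hv : ∀ t ∈ Set.uIcc a b, HasDerivAt v (-(N ^ 2 + q t) * u t) t)
    (hq : ∀ t ∈ Set.uIcc a b, |q t| ≤ Q) :
    |u b ^ 2 - (u a * cos (N * (b - a)) + v a / N * sin (N * (b - a))) ^ 2|
      ≤ 2 * Q * |b - a| * exp (Q * |b - a|) * (u a ^ 2 + (v a / N) ^ 2) / N := by
  have hN0 : 0 < N := by linarith
  have hQ : 0 ≤ Q := (abs_nonneg _).trans (hq a Set.left_mem_uIcc)
  set M := (u a ^ 2 + (v a / N) ^ 2) * exp (Q * |b - a|) with hM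
  have hE : ∀ t ∈ Set.uIcc a b, u t ^ 2 + (v t / N) ^ 2 ≤ M := by
    intro t ht
    have hsub : Set.uIcc a t ⊆ Set.uIcc a b := Set.uIcc_subset_uIcc_left ht
    have h := le_mul_exp_of_abs_deriv_le (f := fun t => u t ^ 2 + (v t / N) ^ 2)
      (f' := fun t => -(2 * q t * u t * v t / N ^ 2)) (a := a) (b := t) (K := Q)
      (fun s hs => by
        have h1 := ((hu s (hsub hs)).pow 2).add (((hv s (hsub hs)).div_const N).pow 2)
        refine h1.congr_deriv ?_
        simp
        field_simp
        ring)
      (fun s hs => by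
        have h2 : |2 * u s * (v s / N)| ≤ u s ^ 2 + (v s / N) ^ 2 := by
          rw [abs_le]
          constructor <;> nlinarith [sq_nonneg (u s + v s / N), sq_nonneg (u s - v s / N)]
        have h3 : -(2 * q s * u s * v s / N ^ 2) = -(q s / N) * (2 * u s * (v s / N)) := by
          field_simp
        have h4 : |-(q s / N)| ≤ Q := by
          rw [abs_neg, abs_div, abs_of_pos hN0, div_le_iff₀ hN0]
          nlinarith [hq s (hsub hs)]
        rw [h3, abs_mul]
        exact mul_le_mul h4 h2 (abs_nonneg _) hQ)
    refine h.trans ?_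
    have hab : |t - a| ≤ |b - a| := Set.abs_sub_left_of_mem_uIcc ht
    rw [hM]
    gcongr
  have hM0 : 0 ≤ M := by positivity
  have hsqrt : ∀ x : ℝ, x ^ 2 ≤ M → |x| ≤ √M := fun x hx => abs_le_sqrt hx
  have hub : ∀ t ∈ Set.uIcc a b, |u t| ≤ √M := fun t ht =>
    hsqrt _ (by nlinarith [hE t ht, sq_nonneg (v t / N)])
  set w : ℝ → ℝ := fun t => u t * cos (N * (b - t)) + v t / N * sin (N * (b - t)) with hw
  have hdw : ∀ t ∈ Set.uIcc a b, HasDerivAt w (-(q t * u t / N * sin (N * (b - t)))) t := by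
    intro t ht
    have h0 : HasDerivAt (fun t : ℝ => N * (b - t)) (-N) t := by
      simpa using ((hasDerivAt_id t).const_sub b).const_mul N
    refine (((hu t ht).mul h0.cos).add (((hv t ht).div_const N).mul h0.sin)).congr_deriv ?_
    field_simp
    ring
  have hdiff : |w b - w a| ≤ Q * √M / N * |b - a| := by
    refine Convex.norm_image_sub_le_of_norm_hasDerivWithin_le
      (fun t ht => (hdw t ht).hasDerivWithinAt) (fun t ht => ?_) (convex_uIcc a b)
      Set.left_mem_uIcc Set.right_mem_uIcc
    rw [norm_neg, Real.norm_eq_abs, abs_mul, abs_div, abs_mul, abs_of_pos hN0]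
    have h1 := mul_le_mul (hq t ht) (hub t ht) (abs_nonneg _) hQ
    calc |q t| * |u t| / N * |sin (N * (b - t))| ≤ Q * √M / N * 1 := by
          gcongr
          exact abs_sin_le_one _
      _ = _ := mul_one _
  have hwb : w b = u b := by simp [hw]
  have hwa : |w a| ≤ √M := by
    refine hsqrt _ (le_trans ?_ (hE a Set.left_mem_uIcc))
    have := sin_sq_add_cos_sq (N * (b - a))
    simp only [hw]
    set c := cos (N * (b - a))
    set s := sin (N * (b - a))
    nlinarith [sq_nonneg (u a * s - v a / N * c)]
  rw [hwb] at hdiff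
  have hsum : |u b + w a| ≤ 2 * √M := by
    linarith [abs_add_le (u b) (w a), hub b Set.right_mem_uIcc]
  calc |u b ^ 2 - w a ^ 2| = |u b - w a| * |u b + w a| := by
        rw [← abs_mul]; ring_nf
    _ ≤ (Q * √M / N * |b - a|) * (2 * √M) := by gcongr
    _ = 2 * Q * |b - a| * √M ^ 2 / N := by ring
    _ = _ := by rw [sq_sqrt hM0, hM]; ring

/-! ### Liouville's normal form of Legendre's equation -/

lemma hasDerivAt_sqrt_sin {t : ℝ} (ht : 0 < sin t) :
    HasDerivAt (fun t => √(sin t)) (cos t / (2 * √(sin t))) t :=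
  (hasDerivAt_sin t).sqrt ht.ne'

lemma hasDerivAt_eval_cos (p : Polynomial ℝ) (t : ℝ) :
    HasDerivAt (fun t => p.eval (cos t)) (-(p.derivative.eval (cos t) * sin t)) t := by
  exact ((p.hasDerivAt (cos t)).comp t (hasDerivAt_cos t)).congr_deriv (by ring)

lemma hasDerivAt_sqrt_sin_mul_eval_cos (p : Polynomial ℝ) {t : ℝ} (ht : 0 < sin t) :
    HasDerivAt (fun t => √(sin t) * p.eval (cos t))
      (cos t / (2 * √(sin t)) * p.eval (cos t)
        - √(sin t) * (p.derivative.eval (cos t) * sin t)) t :=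
  ((hasDerivAt_sqrt_sin ht).mul (hasDerivAt_eval_cos p t)).congr_deriv (by ring)

lemma hasDerivAt_deriv_sqrt_sin_mul_legendreP (n : ℕ) {t : ℝ} (ht : 0 < sin t) :
    HasDerivAt (fun t => cos t / (2 * √(sin t)) * (legendreP n).eval (cos t)
        - √(sin t) * ((legendreP n).derivative.eval (cos t) * sin t))
      (-(((n : ℝ) + 1 / 2) ^ 2 + 1 / (4 * sin t ^ 2)) *
        (√(sin t) * (legendreP n).eval (cos t))) t := by
  have hs : 0 < √(sin t) := sqrt_pos.2 ht
  have h1 := hasDerivAt_sqrt_sin ht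
  have h2 := hasDerivAt_eval_cos (legendreP n) t
  have h3 := hasDerivAt_eval_cos (legendreP n).derivative t
  have h4 := (((hasDerivAt_cos t).div (h1.const_mul 2) (by positivity)).mul h2).sub
    (h1.mul (h3.mul (hasDerivAt_sin t)))
  refine h4.congr_deriv ?_
  simp only [Pi.mul_apply, Pi.div_apply]
  have hode := legendreP_ode n (cos t)
  have hsin : sin t = √(sin t) ^ 2 := (sq_sqrt ht.le).symm
  have hcos : cos t ^ 2 = 1 - √(sin t) ^ 4 := by
    have := sin_sq_add_cos_sq t
    rw [hsin] at this
    linear_combination this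
  set s := √(sin t)
  rw [hsin]
  set x := cos t
  set p := (legendreP n).eval x
  set p' := (legendreP n).derivative.eval x
  set p'' := (legendreP n).derivative.derivative.eval x
  rw [hcos] at hode
  field_simp
  linear_combination 16 * s ^ 4 * hode - 4 * p * hcos

/-- The squared amplitude of the oscillation of `√(sin t) * P_n (cos t)` at `t = π / 2`. -/
lemma legendreP_amplitude (n : ℕ) (hn : 1 ≤ n) :
    |(2 * (n : ℝ) + 1) * ((legendreP n).eval 0 ^ 2
        + ((legendreP n).derivative.eval 0 / (n + 1 / 2)) ^ 2) - 4 / π| ≤ 4 / π / n := by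
  set A := (2 * (n : ℝ) + 1) * ((legendreP n).eval 0 ^ 2
        + ((legendreP n).derivative.eval 0 / (n + 1 / 2)) ^ 2) with hA
  have hπ := pi_pos
  have hr : ∀ m : ℕ, ∃ r, π = 2 * Wallis.W m * r ∧ 1 ≤ r ∧ r ≤ (2 * m + 2) / (2 * m + 1) := by
    intro m
    have hW := Wallis.W_pos m
    have hle := Wallis.W_le m
    have hge := Wallis.le_W m
    refine ⟨π / 2 / Wallis.W m, by field_simp, by rwa [le_div_iff₀ hW, one_mul], ?_⟩
    rw [div_le_div_iff₀ hW (by positivity)]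
    rw [div_mul_eq_mul_div, div_le_iff₀ (by positivity)] at hge
    linarith
  suffices h : |A * π / 4 - 1| ≤ 1 / n by
    have e : A - 4 / π = 4 / π * (A * π / 4 - 1) := by field_simp
    rw [e, abs_mul, abs_of_pos (by positivity), div_eq_mul_one_div (4 / π) (n : ℝ)]
    gcongr
  rcases n.even_or_odd' with ⟨m, rfl | rfl⟩
  · have hW := Wallis.W_pos m
    obtain ⟨r, hπr, hr1, hr2⟩ := hr m
    have h := legendreP_even_eval_zero_sq m
    have hA' : A = (4 * m + 1) / ((2 * m + 1) * Wallis.W m) := by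
      rw [hA, derivative_legendreP_even_eval_zero, eq_div_iff (by positivity)]
      push_cast
      linear_combination (4 * m + 1 : ℝ) * h
    have e : A * π / 4 = (4 * m + 1) / (2 * (2 * m + 1)) * r := by
      rw [hA', hπr]
      field_simp
      ring
    have hm : (1 : ℝ) ≤ m := by
      have : 1 ≤ m := by omega
      exact_mod_cast this
    rw [e, abs_le]
    push_cast
    constructor
    · have h1 : (4 * m + 1 : ℝ) / (2 * (2 * m + 1)) * 1 ≤ (4 * m + 1) / (2 * (2 * m + 1)) * r := by
        gcongr
      refine le_trans ?_ (sub_le_sub_right h1 1)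
      rw [← sub_nonneg]
      have e2 : (4 * m + 1 : ℝ) / (2 * (2 * m + 1)) * 1 - 1 - -(1 / (2 * m))
          = (m + 1) / (2 * m * (2 * m + 1)) := by
        field_simp
        ring
      rw [e2]
      positivity
    · have h1 : (4 * m + 1 : ℝ) / (2 * (2 * m + 1)) * r
          ≤ (4 * m + 1) / (2 * (2 * m + 1)) * ((2 * m + 2) / (2 * m + 1)) := by
        gcongr
      refine (sub_le_sub_right h1 1).trans ?_
      rw [← sub_nonneg]
      have e2 : 1 / (2 * m) - ((4 * m + 1 : ℝ) / (2 * (2 * m + 1)) * ((2 * m + 2) / (2 * m + 1)) - 1)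
          = (2 * m ^ 2 + 4 * m + 1) / (2 * m * (2 * m + 1) ^ 2) := by
        field_simp
        ring
      rw [e2]
      positivity
  · have hW := Wallis.W_pos m
    obtain ⟨r, hπr, hr1, hr2⟩ := hr m
    have h := derivative_legendreP_odd_eval_zero_sq m
    have hA' : A = 4 * (2 * m + 1) / ((4 * m + 3) * Wallis.W m) := by
      rw [hA, legendreP_odd_eval_zero, eq_div_iff (by positivity)]
      push_cast
      field_simp
      linear_combination (16 * m + 12 : ℝ) * h
    have e : A * π / 4 = 2 * (2 * m + 1) / (4 * m + 3) * r := by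
      rw [hA', hπr]
      field_simp
    rw [e, abs_le]
    push_cast
    constructor
    · have h1 : 2 * (2 * m + 1 : ℝ) / (4 * m + 3) * 1 ≤ 2 * (2 * m + 1) / (4 * m + 3) * r := by
        gcongr
      refine le_trans ?_ (sub_le_sub_right h1 1)
      rw [← sub_nonneg]
      have e2 : 2 * (2 * m + 1 : ℝ) / (4 * m + 3) * 1 - 1 - -(1 / (2 * m + 1))
          = (2 * m + 2) / ((2 * m + 1) * (4 * m + 3)) := by
        field_simp
        ring
      rw [e2]
      positivity
    · have h1 : 2 * (2 * m + 1 : ℝ) / (4 * m + 3) * r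
          ≤ 2 * (2 * m + 1) / (4 * m + 3) * ((2 * m + 2) / (2 * m + 1)) := by
        gcongr
      refine (sub_le_sub_right h1 1).trans ?_
      rw [← sub_nonneg]
      have e2 : 1 / (2 * m + 1)
            - (2 * (2 * m + 1 : ℝ) / (4 * m + 3) * ((2 * m + 2) / (2 * m + 1)) - 1)
          = (2 * m + 2) / ((2 * m + 1) * (4 * m + 3)) := by
        field_simp
        ring
      rw [e2]
      positivity

lemma legendreP_initial_phase (n : ℕ) (θ : ℝ) :
    ((legendreP n).eval 0 * cos (((n : ℝ) + 1 / 2) * (θ - π / 2))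
        + -(legendreP n).derivative.eval 0 / (n + 1 / 2) *
          sin (((n : ℝ) + 1 / 2) * (θ - π / 2))) ^ 2
      = ((legendreP n).eval 0 ^ 2 + ((legendreP n).derivative.eval 0 / (n + 1 / 2)) ^ 2)
        * sin (n * θ + θ / 2 + π / 4) ^ 2 := by
  rcases n.even_or_odd' with ⟨m, rfl | rfl⟩
  · have e : ((2 * m : ℕ) + 1 / 2 : ℝ) * (θ - π / 2)
        = ((2 * m : ℕ) * θ + θ / 2 + π / 4 - π / 2) - m * π := by push_cast; ring
    have hs : ((-1 : ℝ) ^ m) ^ 2 = 1 := by rw [← pow_mul, mul_comm, pow_mul]; norm_num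
    rw [derivative_legendreP_even_eval_zero, e, cos_sub_nat_mul_pi, cos_sub_pi_div_two]
    linear_combination ((legendreP (2 * m)).eval 0 ^ 2 *
      sin ((2 * m : ℕ) * θ + θ / 2 + π / 4) ^ 2) * hs
  · have e : ((2 * m + 1 : ℕ) + 1 / 2 : ℝ) * (θ - π / 2)
        = ((2 * m + 1 : ℕ) * θ + θ / 2 + π / 4) - (m + 1 : ℕ) * π := by push_cast; ring
    have hs : ((-1 : ℝ) ^ (m + 1)) ^ 2 = 1 := by rw [← pow_mul, mul_comm, pow_mul]; norm_num
    rw [legendreP_odd_eval_zero, e, sin_sub_nat_mul_pi]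
    set S := sin ((2 * m + 1 : ℕ) * θ + θ / 2 + π / 4)
    set D := (legendreP (2 * m + 1)).derivative.eval 0
    linear_combination ((D / ((2 * m + 1 : ℕ) + 1 / 2)) ^ 2 * S ^ 2) * hs

/-- Hilb-type asymptotics: for  there is  with
 for all . -/
theorem legendre_hilb_asymptotics (θ : ℝ) (hθ : θ ∈ Set.Ioo 0 π) :
    ∃ C > 0, ∀ ℓ : ℕ, 1 ≤ ℓ →
      |(2 * (ℓ : ℝ) + 1) * ((legendreP ℓ).eval (Real.cos θ)) ^ 2
        - (4 / (π * Real.sin θ)) * Real.sin ((ℓ : ℝ) * θ + θ / 2 + π / 4) ^ 2|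
        ≤ C / (ℓ : ℝ) := by
  obtain ⟨hθ0, hθπ⟩ := hθ
  have hsub : ∀ t ∈ Set.uIcc (π / 2) θ, 0 < sin t := by
    intro t ht
    have hs : Set.uIcc (π / 2) θ ⊆ Set.Ioo 0 π :=
      Set.ordConnected_Ioo.uIcc_subset ⟨by positivity, by linarith [pi_pos]⟩ ⟨hθ0, hθπ⟩
    exact sin_pos_of_mem_Ioo (hs ht)
  have hsin := hsub θ Set.right_mem_uIcc
  obtain ⟨Q, hQ⟩ := isCompact_uIcc.exists_bound_of_continuousOn
    (f := fun t => 1 / (4 * sin t ^ 2)) (s := Set.uIcc (π / 2) θ)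
    (ContinuousOn.div continuousOn_const (by fun_prop)
      fun t ht => by have := hsub t ht; positivity)
  have hQ0 : 0 ≤ Q := (norm_nonneg _).trans (hQ _ Set.left_mem_uIcc)
  set K := 2 * Q * |θ - π / 2| * exp (Q * |θ - π / 2|) with hK
  have hK0 : 0 ≤ K := by positivity
  refine ⟨(K * (8 / π) + 4 / π) / sin θ, by positivity, fun n hn => ?_⟩
  have hn1 : (1 : ℝ) ≤ n := by exact_mod_cast hn
  have key := abs_sq_sub_sq_oscillator_le (N := (n : ℝ) + 1 / 2) (by linarith)
    (fun t ht => hasDerivAt_sqrt_sin_mul_eval_cos (legendreP n) (hsub t ht))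
    (fun t ht => hasDerivAt_deriv_sqrt_sin_mul_legendreP n (hsub t ht)) hQ
  have hamp := legendreP_amplitude n hn
  have hphase := legendreP_initial_phase n θ
  simp only [sin_pi_div_two, cos_pi_div_two, sqrt_one, zero_div, zero_mul, zero_sub, one_mul,
    mul_one, ← hK, neg_div, neg_sq] at key hphase
  rw [hphase, mul_pow, sq_sqrt hsin.le] at key
  set E := (legendreP n).eval 0 ^ 2 + ((legendreP n).derivative.eval 0 / (n + 1 / 2)) ^ 2
  set S := sin ((n : ℝ) * θ + θ / 2 + π / 4) ^ 2
  set p := (legendreP n).eval (cos θ)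
  have hE0 : 0 ≤ E := by positivity
  have hS0 : 0 ≤ S := sq_nonneg _
  have hS1 : S ≤ 1 := sin_sq_le_one _
  have hE : (2 * (n : ℝ) + 1) * E ≤ 8 / π := by
    have h1 : 4 / π / n ≤ 4 / π := div_le_self (by positivity) hn1
    have h2 : 8 / π = 4 / π + 4 / π := by ring
    linarith [(abs_le.1 hamp).2]
  have hmain : |(2 * (n : ℝ) + 1) * (sin θ * p ^ 2 - E * S)| ≤ K * (8 / π) / n := by
    rw [abs_mul, abs_of_pos (by positivity)]
    calc (2 * (n : ℝ) + 1) * |sin θ * p ^ 2 - E * S|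
        ≤ (2 * (n : ℝ) + 1) * (K * E / (n + 1 / 2)) := by gcongr
      _ = K * ((2 * (n : ℝ) + 1) * E) / (n + 1 / 2) := by ring
      _ ≤ K * (8 / π) / n := by
        gcongr
        linarith
  have hosc : |((2 * (n : ℝ) + 1) * E - 4 / π) * S| ≤ 4 / π / n := by
    rw [abs_mul, abs_of_nonneg hS0]
    exact (mul_le_of_le_one_right (abs_nonneg _) hS1).trans hamp
  have e : (2 * (n : ℝ) + 1) * p ^ 2 - 4 / (π * sin θ) * S
      = ((2 * (n : ℝ) + 1) * (sin θ * p ^ 2 - E * S)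
        + ((2 * (n : ℝ) + 1) * E - 4 / π) * S) / sin θ := by
    field_simp
    ring
  rw [e, abs_div, abs_of_pos hsin, div_right_comm]
  gcongr
  rw [add_div]
  exact (abs_add_le _ _).trans (add_le_add hmain hosc)
end

section
/- For every z ∈ (−1, 1) there exists a constant C > 0 such that (2ℓ+1) · P_ℓ(z)² ≤ C for all integers ℓ ≥ 0; equivalently, sup_{ℓ ≥ 0} √(2ℓ+1) · |P_ℓ(z)| < ∞. -/
open Real Filter Finset

/-- Multiplying by `2 ^ n * n!` turns `legendreP n` back into an iterated derivative. -/
lemma smul_legendreP (n : ℕ) :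
    Polynomial.C (2 ^ n * n.factorial : ℝ) * legendreP n =
      Polynomial.derivative^[n] ((Polynomial.X ^ 2 - 1) ^ n) := by
  have h : (2 ^ n * n.factorial : ℝ) ≠ 0 := by positivity
  rw [legendreP, ← Polynomial.smul_eq_C_mul, smul_inv_smul₀ h]

lemma iterate_derivative_X_mul_sq_sub_one_pow (n : ℕ) :
    Polynomial.derivative^[n] (Polynomial.X * (Polynomial.X ^ 2 - 1) ^ n) =
      Polynomial.C (2 ^ n * n.factorial : ℝ) * legendreP (n + 1) := by
  have hd : Polynomial.derivative ((Polynomial.X ^ 2 - 1 : Polynomial ℝ) ^ (n + 1)) =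
      Polynomial.C (2 * (n + 1) : ℝ) * (Polynomial.X * (Polynomial.X ^ 2 - 1) ^ n) := by
    simp [Polynomial.derivative_pow]
    ring
  have h := smul_legendreP (n + 1)
  rw [Function.iterate_succ_apply, hd, Polynomial.iterate_derivative_C_mul] at h
  have hc : Polynomial.C (2 * (n + 1) : ℝ) ≠ 0 := by
    rw [Polynomial.C_ne_zero]
    positivity
  apply mul_left_cancel₀ hc
  rw [← h, ← mul_assoc, ← Polynomial.C_mul, Nat.factorial_succ]
  push_cast
  ring_nf

/-- The derivative of `P_{n+1}` is `X * D P_n + (n + 1) * P_n`, where `D` is differentiation. -/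
lemma derivative_legendreP_succ (n : ℕ) :
    Polynomial.derivative (legendreP (n + 1)) =
      Polynomial.X * Polynomial.derivative (legendreP n) + ((n : Polynomial ℝ) + 1) * legendreP n := by
  have hc : Polynomial.C (2 ^ n * n.factorial : ℝ) ≠ 0 := by
    rw [Polynomial.C_ne_zero]
    positivity
  apply mul_left_cancel₀ hc
  rw [← Polynomial.derivative_C_mul, ← iterate_derivative_X_mul_sq_sub_one_pow,
    ← Function.iterate_succ_apply' Polynomial.derivative, mul_comm Polynomial.X,
    Polynomial.iterate_derivative_mul_X, Nat.succ_sub_one, Function.iterate_succ_apply',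
    ← smul_legendreP, Polynomial.derivative_C_mul, nsmul_eq_mul]
  push_cast
  ring

/-- `(X² - 1) * D P_n = (n + 1) * (P_{n+1} - X * P_n)`, where `D` is differentiation. -/
lemma sq_sub_one_mul_derivative_legendreP (n : ℕ) :
    (Polynomial.X ^ 2 - 1) * Polynomial.derivative (legendreP n) =
      ((n : Polynomial ℝ) + 1) * (legendreP (n + 1) - Polynomial.X * legendreP n) := by
  have hc : Polynomial.C (2 ^ n * n.factorial : ℝ) ≠ 0 := by
    rw [Polynomial.C_ne_zero]
    positivity
  have h := smul_legendreP (n + 1)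
  have hu : ((Polynomial.X : Polynomial ℝ) ^ 2 - 1) ^ (n + 1) =
      Polynomial.X * (Polynomial.X ^ 2 - 1) ^ n * Polynomial.X - (Polynomial.X ^ 2 - 1) ^ n := by
    ring
  rw [hu, Polynomial.iterate_derivative_sub, Polynomial.iterate_derivative_mul_X,
    Nat.add_sub_cancel, Function.iterate_succ_apply', Function.iterate_succ_apply',
    iterate_derivative_X_mul_sq_sub_one_pow, ← smul_legendreP, Polynomial.derivative_C_mul,
    Polynomial.derivative_C_mul, derivative_legendreP_succ, nsmul_eq_mul,
    show (2 ^ (n + 1) * (n + 1).factorial : ℝ) = 2 ^ n * n.factorial * (2 * (n + 1)) by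
      rw [Nat.factorial_succ]; push_cast; ring, Polynomial.C_mul] at h
  apply mul_left_cancel₀ hc
  simp only [map_mul, map_add, map_natCast, map_one, map_ofNat] at h ⊢
  push_cast at h
  linear_combination -h

/-- Bonnet's recurrence `(n + 2) P_{n+2} = (2n + 3) X P_{n+1} - (n + 1) P_n`. -/
lemma legendreP_add_two (n : ℕ) :
    ((n : Polynomial ℝ) + 2) * legendreP (n + 2) =
      (2 * (n : Polynomial ℝ) + 3) * Polynomial.X * legendreP (n + 1) - ((n : Polynomial ℝ) + 1) * legendreP n := by
  have h₀ := sq_sub_one_mul_derivative_legendreP n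
  have h₁ := sq_sub_one_mul_derivative_legendreP (n + 1)
  rw [derivative_legendreP_succ] at h₁
  push_cast at h₁
  linear_combination -h₁ + Polynomial.X * h₀

/-- A quadratic form, positive definite for large `m`, in `(p (m - 1), p m)`, nearly invariant under the
recurrence `(m + 1) p (m + 1) = (2 m + 1) z p m - m p (m - 1)`. It is expressed through `a = p m`
and `w = p (m - 1) - z * p m`. -/
noncomputable def bonnetEnergy (z m a w : ℝ) : ℝ :=
  (m + 1 / 2) * (1 - z ^ 2) * a ^ 2 + (m - 1 / 2) * w ^ 2 - z * a * w

lemma le_bonnetEnergy {z m : ℝ} (hz : z ^ 2 < 1) (hm : 2 ≤ m * (1 - z ^ 2)) (a w : ℝ) :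
    m * (1 - z ^ 2) / 2 * (a ^ 2 + w ^ 2) ≤ bonnetEnergy z m a w := by
  have hm2 : 2 ≤ m := by nlinarith [sq_nonneg z]
  have hzaw : z * a * w ≤ (a ^ 2 + w ^ 2) / 2 := by
    nlinarith [sq_nonneg (z * a - w), mul_nonneg (sub_nonneg.2 hz.le) (sq_nonneg a)]
  unfold bonnetEnergy
  have ha : 0 ≤ (m * (1 - z ^ 2) / 2 + (1 - z ^ 2) / 2 - 1 / 2) * a ^ 2 :=
    mul_nonneg (by linarith) (sq_nonneg a)
  have hw : 0 ≤ (m - 1 / 2 - m * (1 - z ^ 2) / 2 - 1 / 2) * w ^ 2 :=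
    mul_nonneg (by nlinarith [mul_nonneg (by linarith : 0 ≤ m) (sq_nonneg z)]) (sq_nonneg w)
  linarith

lemma bonnetEnergy_succ_le {z m a w b : ℝ} (hz : z ^ 2 < 1) (hm : 0 ≤ m)
    (hb : b = z * a - w + w / (m + 1)) :
    bonnetEnergy z (m + 1) b (a - z * b) ≤ bonnetEnergy z m a w + (a ^ 2 + w ^ 2) / (m + 1) := by
  have hm1 : 0 < m + 1 := by linarith
  have heq : bonnetEnergy z (m + 1) b (a - z * b) =
      bonnetEnergy z m a w + (z * a * w + w ^ 2 / (2 * (m + 1))) / (m + 1) := by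
    subst hb
    unfold bonnetEnergy
    field_simp
    ring
  have hw : w ^ 2 / (2 * (m + 1)) ≤ w ^ 2 / 2 :=
    div_le_div_of_nonneg_left (sq_nonneg w) two_pos (by linarith)
  have hzaw : z * a * w ≤ (a ^ 2 + w ^ 2) / 2 := by
    nlinarith [sq_nonneg (z * a - w), mul_nonneg (sub_nonneg.2 hz.le) (sq_nonneg a)]
  rw [heq]
  refine add_le_add le_rfl (div_le_div_of_nonneg_right ?_ hm1.le)
  linarith [sq_nonneg a]

/-- A sequence satisfying Bonnet's recurrence at a point of `(-1, 1)` is `O(n ^ (-1/2))`. -/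
lemma exists_bound_of_bonnet_recurrence {z : ℝ} (hz : z ^ 2 < 1) (p : ℕ → ℝ)
    (hp : ∀ n : ℕ, (n + 2) * p (n + 2) = (2 * n + 3) * z * p (n + 1) - (n + 1) * p n) :
    ∃ C, ∀ n : ℕ, (2 * (n : ℝ) + 1) * p n ^ 2 ≤ C := by
  set c := 1 - z ^ 2 with hc
  have hc0 : 0 < c := by linarith
  let F : ℕ → ℝ := fun n => bonnetEnergy z (n + 1) (p (n + 1)) (p n - z * p (n + 1))
  let G : ℕ → ℝ := fun n => F n * (1 + 4 / c / (n + 1))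
  obtain ⟨N, hN⟩ := exists_nat_ge (4 / c)
  have hlarge : ∀ n : ℕ, N ≤ n → 4 ≤ (n + 1 : ℝ) * c := by
    intro n hn
    have : (N : ℝ) ≤ n := by exact_mod_cast hn
    rw [← div_le_iff₀ hc0]
    linarith
  have hlower : ∀ n : ℕ, N ≤ n →
      (n + 1 : ℝ) * c / 2 * (p (n + 1) ^ 2 + (p n - z * p (n + 1)) ^ 2) ≤ F n :=
    fun n hn => le_bonnetEnergy hz (by linarith [hlarge n hn]) _ _
  have hF0 : ∀ n : ℕ, N ≤ n → 0 ≤ F n := fun n hn =>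
    le_trans (by positivity) (hlower n hn)
  have hstep : ∀ n : ℕ, N ≤ n → G (n + 1) ≤ G n := by
    intro n hn
    have hn1 : (0 : ℝ) < n + 1 := by positivity
    have hF := bonnetEnergy_succ_le (m := n + 1) (a := p (n + 1)) (w := p n - z * p (n + 1))
      (b := p (n + 2)) hz hn1.le (by
        have := hp n
        field_simp
        linear_combination this)
    have hF' : F (n + 1) ≤ F n * (1 + 2 / c / ((n + 1) * (n + 2))) := by
      have hS : (p (n + 1) ^ 2 + (p n - z * p (n + 1)) ^ 2) / ((n : ℝ) + 1 + 1) ≤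
          F n * (2 / c / ((n + 1) * (n + 2))) := by
        have h2 : F n * (2 / c / ((n + 1) * (n + 2))) =
            F n / ((n + 1) * c / 2) / ((n : ℝ) + 1 + 1) := by
          field_simp
          ring
        rw [h2]
        gcongr
        rw [le_div_iff₀ (by positivity), mul_comm]
        exact hlower n hn
      have hFn : F (n + 1) = bonnetEnergy z ((n : ℝ) + 1 + 1) (p (n + 2))
          (p (n + 1) - z * p (n + 2)) := by
        simp only [F]
        push_cast
        rfl
      rw [hFn]
      linarith
    have hmul : (1 + 2 / c / ((n + 1) * (n + 2))) * (1 + 4 / c / ((n : ℝ) + 2)) ≤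
        1 + 4 / c / (n + 1) := by
      have h4 : 4 / c / ((n : ℝ) + 2) ≤ 1 := by
        rw [div_div, div_le_one (by positivity)]
        nlinarith [hlarge n hn]
      have hsplit : 4 / c / ((n : ℝ) + 1) =
          4 / c / (n + 2) + 2 / c / ((n + 1) * (n + 2)) * 2 := by
        field_simp
        ring
      have hpos : 0 ≤ 2 / c / (((n : ℝ) + 1) * (n + 2)) := by positivity
      rw [hsplit]
      nlinarith
    calc G (n + 1) = F (n + 1) * (1 + 4 / c / ((n : ℝ) + 2)) := by
          simp only [G]
          push_cast
          ring
      _ ≤ F n * (1 + 2 / c / ((n + 1) * (n + 2))) * (1 + 4 / c / ((n : ℝ) + 2)) := by gcongr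
      _ ≤ G n := by
          rw [mul_assoc]
          exact mul_le_mul_of_nonneg_left hmul (hF0 n hn)
  have hG : ∀ n, N ≤ n → G n ≤ G N := by
    intro n hn
    induction n, hn using Nat.le_induction with
    | base => exact le_rfl
    | succ n hn ih => exact (hstep n hn).trans ih
  have htail : ∀ n : ℕ, N ≤ n → (2 * ((n + 1 : ℕ) : ℝ) + 1) * p (n + 1) ^ 2 ≤ 6 / c * G N := by
    intro n hn
    have hFG : F n ≤ G n :=
      le_mul_of_one_le_right (hF0 n hn) (le_add_of_nonneg_right (by positivity))
    have h : (n + 1 : ℝ) * c / 2 * p (n + 1) ^ 2 ≤ G N := by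
      refine le_trans ?_ ((hlower n hn).trans (hFG.trans (hG n hn)))
      gcongr
      exact le_add_of_nonneg_right (sq_nonneg _)
    calc (2 * ((n + 1 : ℕ) : ℝ) + 1) * p (n + 1) ^ 2 ≤ 3 * (n + 1) * p (n + 1) ^ 2 := by
          gcongr
          push_cast
          linarith [(Nat.cast_nonneg n : (0 : ℝ) ≤ n)]
      _ = 6 / c * ((n + 1 : ℝ) * c / 2 * p (n + 1) ^ 2) := by
          field_simp
          ring
      _ ≤ 6 / c * G N := by gcongr
  have hbdd : IsBoundedUnder (· ≤ ·) atTop fun n : ℕ => (2 * (n : ℝ) + 1) * p n ^ 2 := by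
    refine ⟨6 / c * G N, eventually_map.2 ?_⟩
    filter_upwards [eventually_ge_atTop (N + 1)] with n hn
    obtain ⟨k, rfl⟩ : ∃ k, n = k + 1 := ⟨n - 1, by omega⟩
    exact htail k (by omega)
  obtain ⟨C, hC⟩ := hbdd.bddAbove_range
  exact ⟨C, fun n => hC ⟨n, rfl⟩⟩

/-- For every `z ∈ (-1,1)` there is `C > 0` such that `(2ℓ+1) P_ℓ(z)^2 ≤ C` for all `ℓ ≥ 0`;
equivalently, `√(2ℓ+1) |P_ℓ(z)|` is bounded uniformly in `ℓ`. -/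
theorem legendre_sq_uniform_bound (z : ℝ) (hz : z ∈ Set.Ioo (-1 : ℝ) 1) :
    ∃ C > 0, ∀ ℓ : ℕ, (2 * (ℓ : ℝ) + 1) * ((legendreP ℓ).eval z) ^ 2 ≤ C := by
  obtain ⟨C, hC⟩ := exists_bound_of_bonnet_recurrence (z := z)
    (by nlinarith [mul_pos (sub_pos.2 hz.1) (sub_pos.2 hz.2)]) (fun n => (legendreP n).eval z)
    fun n => by simpa using congrArg (Polynomial.eval z) (legendreP_add_two n)
  exact ⟨max C 1, by positivity, fun ℓ => (hC ℓ).trans (le_max_left _ _)⟩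
end

section
/- For every z ∈ (−1, 1) there exists a constant C > 0 such that for all integers L ≥ 2, Σ_{ℓ=1}^{L} (2ℓ+1) · P_ℓ(z)⁴ ≤ C · log L. -/
open Real Filter Finset

open Polynomial in
theorem iterate_derivative_sq_sub_one_pow_recurrence (n : ℕ) :
    derivative^[n + 2] ((X ^ 2 - 1 : ℝ[X]) ^ (n + 2)) =
      C (2 * (2 * (n : ℝ) + 3)) * (X * derivative^[n + 1] ((X ^ 2 - 1 : ℝ[X]) ^ (n + 1)))
        - C (4 * ((n : ℝ) + 1) ^ 2) * derivative^[n] ((X ^ 2 - 1 : ℝ[X]) ^ n) := by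
  set S : ℝ[X] := derivative^[n] ((X ^ 2 - 1 : ℝ[X]) ^ (n + 1)) with hS
  have hd : derivative ((X ^ 2 - 1 : ℝ[X]) ^ (n + 2)) =
      C (2 * ((n : ℝ) + 2)) * (X * (X ^ 2 - 1) ^ (n + 1)) := by
    simp [derivative_pow]
    ring
  have hdd : derivative (derivative ((X ^ 2 - 1 : ℝ[X]) ^ (n + 2))) =
      C (2 * ((n : ℝ) + 2) * (2 * n + 3)) * (X ^ 2 - 1) ^ (n + 1) +
        C (4 * ((n : ℝ) + 1) * (n + 2)) * (X ^ 2 - 1) ^ n := by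
    rw [hd]
    rw [derivative_C_mul]
    simp only [derivative_mul, derivative_pow_succ, derivative_X, derivative_sub,
      derivative_one, Nat.cast_one, C_mul, C_add, C_ofNat, C_1]
    ring
  have h₁ : derivative^[n + 2] ((X ^ 2 - 1 : ℝ[X]) ^ (n + 2)) =
      C (2 * ((n : ℝ) + 2) * (2 * n + 3)) * S +
        C (4 * ((n : ℝ) + 1) * (n + 2)) * derivative^[n] ((X ^ 2 - 1 : ℝ[X]) ^ n) := by
    rw [Function.iterate_succ_apply, Function.iterate_succ_apply, hdd, iterate_map_add,
      iterate_derivative_C_mul, iterate_derivative_C_mul]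
  have h₂ : derivative^[n + 2] ((X ^ 2 - 1 : ℝ[X]) ^ (n + 2)) =
      C (2 * ((n : ℝ) + 2)) * (X * derivative^[n + 1] ((X ^ 2 - 1 : ℝ[X]) ^ (n + 1)) +
        C ((n : ℝ) + 1) * S) := by
    rw [Function.iterate_succ_apply, hd, iterate_derivative_C_mul,
      mul_comm X ((X ^ 2 - 1 : ℝ[X]) ^ (n + 1)), iterate_derivative_mul_X]
    simp [hS, mul_comm X]
  have hn : (C ((n : ℝ) + 2) : ℝ[X]) ≠ 0 := by
    rw [Ne, C_eq_zero]; positivity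
  apply mul_left_cancel₀ hn
  simp only [C_mul, C_add, C_pow, C_ofNat, C_1] at *
  linear_combination (2 * C (n : ℝ) + 3) * h₂ - (C (n : ℝ) + 1) * h₁

/-- Bonnet's three-term recurrence. -/
theorem legendreP_eval_recurrence (n : ℕ) (x : ℝ) :
    ((n : ℝ) + 2) * (legendreP (n + 2)).eval x =
      (2 * n + 3) * x * (legendreP (n + 1)).eval x - (n + 1) * (legendreP n).eval x := by
  have h := congrArg (Polynomial.eval x) (iterate_derivative_sq_sub_one_pow_recurrence n)
  simp only [Polynomial.eval_sub, Polynomial.eval_mul, Polynomial.eval_C, Polynomial.eval_X] at h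
  simp only [legendreP, Polynomial.eval_smul, smul_eq_mul]
  rw [h, Nat.factorial_succ (n + 1), Nat.factorial_succ n]
  have := Nat.factorial_pos n
  push_cast
  field_simp
  ring

/-- If `a` satisfies the Legendre recurrence, then `a n = O(1 / √n)`. -/
theorem exists_mul_sq_le_of_legendre_recurrence {x : ℝ} (hx : x ^ 2 < 1) {a : ℕ → ℝ}
    (ha : ∀ n : ℕ, ((n : ℝ) + 2) * a (n + 2) = (2 * n + 3) * x * a (n + 1) - (n + 1) * a n) :
    ∃ K, ∀ n : ℕ, n * a n ^ 2 ≤ K := by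
  have hδ : 0 < 1 - x ^ 2 := by linarith
  set c : ℝ := 1 / (1 - x ^ 2) with hc
  have hc1 : 1 ≤ c := by
    rw [hc, le_div_iff₀ hδ]; nlinarith [sq_nonneg x]
  have hcδ : c * (1 - x ^ 2) = 1 := by rw [hc]; field_simp
  let Q : ℕ → ℝ := fun n => a (n + 1) ^ 2 - 2 * x * a (n + 1) * a n + a n ^ 2
  let F : ℕ → ℝ := fun n => (n + 1) * Q n + a (n + 1) ^ 2 - x * a (n + 1) * a n
  have hrec : ∀ n : ℕ, a (n + 2) =
      2 * x * a (n + 1) - a n + (a n - x * a (n + 1)) / (n + 2) := by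
    intro n
    have := ha n
    field_simp
    linarith
  have hQa : ∀ n, a (n + 1) ^ 2 ≤ c * Q n := by
    intro n
    have : (1 - x ^ 2) * a (n + 1) ^ 2 ≤ Q n := by
      simp only [Q]; nlinarith [sq_nonneg (a n - x * a (n + 1))]
    nlinarith [mul_le_mul_of_nonneg_left this (by linarith : 0 ≤ c)]
  have hQb : ∀ n, a n ^ 2 ≤ c * Q n := by
    intro n
    have : (1 - x ^ 2) * a n ^ 2 ≤ Q n := by
      simp only [Q]; nlinarith [sq_nonneg (a (n + 1) - x * a n)]
    nlinarith [mul_le_mul_of_nonneg_left this (by linarith : 0 ≤ c)]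
  have hQu : ∀ n, (a n - x * a (n + 1)) ^ 2 ≤ Q n := by
    intro n
    simp only [Q]; nlinarith [mul_nonneg hδ.le (sq_nonneg (a (n + 1)))]
  have hQ0 : ∀ n, 0 ≤ Q n := fun n => (sq_nonneg _).trans (hQu n)
  have hQsucc : ∀ n, Q (n + 1) ≤ Q n := by
    intro n
    have : Q (n + 1) = Q n - (2 * n + 3) * ((a n - x * a (n + 1)) / (n + 2)) ^ 2 := by
      simp only [Q]
      rw [show n + 1 + 1 = n + 2 from rfl, hrec n]
      field_simp
      ring
    rw [this]
    have : 0 ≤ (2 * (n : ℝ) + 3) * ((a n - x * a (n + 1)) / (n + 2)) ^ 2 := by positivity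
    linarith
  have hFdiff : ∀ n, F (n + 1) = F n + (a n - x * a (n + 1)) * a (n + 2) / (n + 2) := by
    intro n
    simp only [F, Q]
    rw [show n + 1 + 1 = n + 2 from rfl, hrec n]
    push_cast
    field_simp
    ring
  have hFsucc : ∀ n, F (n + 1) ≤ F n + c * Q n / (n + 2) := by
    intro n
    rw [hFdiff, add_le_add_iff_left]
    refine div_le_div_of_nonneg_right ?_ (by positivity)
    have h1 := hQu n
    have h2 := (hQa (n + 1)).trans
      (mul_le_mul_of_nonneg_left (hQsucc n) (by linarith : 0 ≤ c))
    rw [show n + 1 + 1 = n + 2 from rfl] at h2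
    have h3 := mul_le_mul_of_nonneg_right hc1 (hQ0 n)
    nlinarith [sq_nonneg (a n - x * a (n + 1) - a (n + 2))]
  have hFlower : ∀ n : ℕ, ((n : ℝ) + 1 - c) * Q n ≤ F n := by
    intro n
    simp only [F]
    have h1 := hQb n
    have h2 : a (n + 1) ^ 2 - x * a (n + 1) * a n =
      Q n / 2 + (a (n + 1) ^ 2 - a n ^ 2) / 2 := by simp only [Q]; ring
    nlinarith [hQ0 n, sq_nonneg (a (n + 1)), mul_nonneg (by linarith : 0 ≤ c) (hQ0 n)]
  obtain ⟨N, hN⟩ := exists_nat_ge (2 * c)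
  have hNF : ∀ n : ℕ, N ≤ n → ((n : ℝ) + 1) * Q n ≤ 2 * F n := by
    intro n hn
    have : (N : ℝ) ≤ n := by exact_mod_cast hn
    nlinarith [hFlower n, mul_nonneg (by linarith : 0 ≤ (n : ℝ) + 1 - 2 * c) (hQ0 n)]
  have hmono : ∀ n : ℕ, N ≤ n →
      F (n + 1) * exp (2 * c / (n + 2)) ≤ F n * exp (2 * c / (n + 1)) := by
    intro n hn
    have hF0 : 0 ≤ F n := by
      have := hNF n hn
      have : 0 ≤ ((n : ℝ) + 1) * Q n := mul_nonneg (by positivity) (hQ0 n)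
      linarith
    have hstep : F (n + 1) ≤ F n * exp (2 * c / (n + 1) - 2 * c / (n + 2)) := by
      have h1 : c * Q n / (n + 2) ≤ F n * (2 * c / (n + 1) - 2 * c / (n + 2)) := by
        have : F n * (2 * c / (n + 1) - 2 * c / (n + 2)) =
            c * (2 * F n / (n + 1)) / (n + 2) := by field_simp; ring
        rw [this]
        gcongr
        rw [le_div_iff₀ (by positivity)]
        linarith [hNF n hn]
      have h2 := mul_le_mul_of_nonneg_left
        (add_one_le_exp (2 * c / ((n : ℝ) + 1) - 2 * c / (n + 2))) hF0
      linarith [hFsucc n]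
    calc F (n + 1) * exp (2 * c / (n + 2))
        ≤ F n * exp (2 * c / (n + 1) - 2 * c / (n + 2)) * exp (2 * c / (n + 2)) := by gcongr
      _ = F n * exp (2 * c / (n + 1)) := by rw [mul_assoc, ← exp_add]; ring_nf
  set M : ℝ := F N * exp (2 * c / (N + 1)) with hM
  have hbound : ∀ n : ℕ, N ≤ n → F n * exp (2 * c / (n + 1)) ≤ M := by
    intro n hn
    induction n, hn using Nat.le_induction with
    | base => exact le_rfl
    | succ n hn ih =>
      refine le_trans (le_of_eq ?_) ((hmono n hn).trans ih)
      push_cast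
      ring_nf
  have hlarge : ∀ n : ℕ, N ≤ n → (n : ℝ) * a n ^ 2 ≤ 2 * c * M := by
    intro n hn
    have h0 : 0 ≤ ((n : ℝ) + 1) * Q n := mul_nonneg (by positivity) (hQ0 n)
    have h1 := hNF n hn
    have hexp : 1 ≤ exp (2 * c / ((n : ℝ) + 1)) := one_le_exp (by positivity)
    have h2 : F n ≤ M := (le_mul_of_one_le_right (by linarith) hexp).trans (hbound n hn)
    have h3 : ((n : ℝ) + 1) * Q n ≤ 2 * M := by linarith
    have h4 := mul_le_mul_of_nonneg_left (hQb n) (by positivity : 0 ≤ (n : ℝ) + 1)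
    nlinarith [sq_nonneg (a n), mul_le_mul_of_nonneg_left h3 (by linarith : 0 ≤ c)]
  refine ⟨2 * c * M + ∑ i ∈ Finset.range N, (i : ℝ) * a i ^ 2, fun n => ?_⟩
  have hsum : ∀ s : Finset ℕ, 0 ≤ ∑ i ∈ s, (i : ℝ) * a i ^ 2 :=
    fun s => Finset.sum_nonneg fun i _ => by positivity
  rcases le_or_gt N n with hn | hn
  · linarith [hlarge n hn, hsum (Finset.range N)]
  · have h1 := Finset.single_le_sum (f := fun i : ℕ => (i : ℝ) * a i ^ 2)
      (fun i _ => by positivity) (Finset.mem_range.2 hn)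
    have h2 : 0 ≤ 2 * c * M :=
      (by positivity : 0 ≤ (N : ℝ) * a N ^ 2).trans (hlarge N le_rfl)
    linarith

/-- For every `z ∈ (-1,1)` there is `C > 0` such that for all `L ≥ 2`,
`∑_{ℓ=1}^{L} (2ℓ+1) P_ℓ(z)^4 ≤ C log L`. -/
theorem legendre_fourth_power_log_bound (z : ℝ) (hz : z ∈ Set.Ioo (-1 : ℝ) 1) :
    ∃ C > 0, ∀ L : ℕ, 2 ≤ L →
      ∑ ℓ ∈ Finset.Icc 1 L, (2 * (ℓ : ℝ) + 1) * ((legendreP ℓ).eval z) ^ 4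
        ≤ C * Real.log L := by
  obtain ⟨K, hK⟩ := exists_mul_sq_le_of_legendre_recurrence (x := z)
    (a := fun n => (legendreP n).eval z) (by nlinarith [hz.1, hz.2])
    (fun n => legendreP_eval_recurrence n z)
  have hlog2 : 0 < Real.log 2 := Real.log_pos (by norm_num)
  refine ⟨(3 * K ^ 2 + 1) * (1 / Real.log 2 + 1), by positivity, fun L hL => ?_⟩
  have hlogL : Real.log 2 ≤ Real.log L :=
    Real.log_le_log (by norm_num) (by exact_mod_cast hL)
  have hterm : ∀ ℓ ∈ Finset.Icc 1 L, (2 * (ℓ : ℝ) + 1) * ((legendreP ℓ).eval z) ^ 4 ≤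
      3 * K ^ 2 * (ℓ : ℝ)⁻¹ := by
    intro ℓ hℓ
    have h1 : (1 : ℝ) ≤ ℓ := by exact_mod_cast (Finset.mem_Icc.1 hℓ).1
    have h2 : ((ℓ : ℝ) * ((legendreP ℓ).eval z) ^ 2) ^ 2 ≤ K ^ 2 :=
      pow_le_pow_left₀ (by positivity) (hK ℓ) 2
    rw [← div_eq_mul_inv, le_div_iff₀ (by positivity)]
    calc (2 * (ℓ : ℝ) + 1) * ((legendreP ℓ).eval z) ^ 4 * ℓ
        ≤ (3 * ℓ) * ((legendreP ℓ).eval z) ^ 4 * ℓ := by gcongr; linarith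
      _ = 3 * ((ℓ : ℝ) * ((legendreP ℓ).eval z) ^ 2) ^ 2 := by ring
      _ ≤ 3 * K ^ 2 := by linarith
  have hharm : ∑ ℓ ∈ Finset.Icc 1 L, (ℓ : ℝ)⁻¹ ≤ 1 + Real.log L := by
    have := harmonic_le_one_add_log L
    rw [harmonic_eq_sum_Icc] at this
    push_cast at this
    exact this
  have hone : 1 ≤ 1 / Real.log 2 * Real.log L := by
    rw [one_div_mul_eq_div, le_div_iff₀ hlog2]; linarith
  calc ∑ ℓ ∈ Finset.Icc 1 L, (2 * (ℓ : ℝ) + 1) * ((legendreP ℓ).eval z) ^ 4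
      ≤ 3 * K ^ 2 * ∑ ℓ ∈ Finset.Icc 1 L, (ℓ : ℝ)⁻¹ := by
        rw [Finset.mul_sum]; exact Finset.sum_le_sum hterm
    _ ≤ (3 * K ^ 2 + 1) * (1 / Real.log 2 * Real.log L + Real.log L) := by
        gcongr <;> linarith
    _ = (3 * K ^ 2 + 1) * (1 / Real.log 2 + 1) * Real.log L := by ring
end

section
/- Let p ≥ 1 be an integer, β > 3/2, γ > 0, z ∈ (−1, 1), and let (φ_ℓ)_{ℓ ≥ 1} be a sequence of vectors in ℝ^p with ‖φ_ℓ‖ ≤ γ · ℓ^{−β} for all ℓ ≥ 1 (Euclidean norm). Then there exists a constant C > 0 (depending on γ, β and z) such that for all integers L ≥ 1, Σ_{ℓ=L+1}^{∞} (2ℓ+1) · ‖φ_ℓ‖ · |P_ℓ(z)| ≤ C · L^{3/2−β}. -/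
open Real Filter Finset

lemma integral_exp_neg_mul_sin_sq_le {c : ℝ} (hc : 0 < c) :
    ∫ x in (-(π / 2))..(π / 2), exp (-c * sin x ^ 2) ≤ √(π / (c * (2 / π) ^ 2)) := by
  have hπ := Real.pi_pos
  have hb : 0 < c * (2 / π) ^ 2 := by positivity
  have hle : -(π / 2) ≤ π / 2 := by linarith
  calc ∫ x in (-(π / 2))..(π / 2), exp (-c * sin x ^ 2)
      ≤ ∫ x in (-(π / 2))..(π / 2), exp (-(c * (2 / π) ^ 2) * x ^ 2) := by
        apply intervalIntegral.integral_mono_on hle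
        · exact Continuous.intervalIntegrable (by fun_prop) _ _
        · exact Continuous.intervalIntegrable (by fun_prop) _ _
        · intro x hx
          have h : 2 / π * |x| ≤ |sin x| :=
            mul_abs_le_abs_sin (abs_le.2 ⟨hx.1, hx.2⟩)
          have h2 : (2 / π * |x|) ^ 2 ≤ |sin x| ^ 2 := by gcongr
          rw [mul_pow, sq_abs, sq_abs] at h2
          apply exp_le_exp.2
          nlinarith
    _ ≤ ∫ x : ℝ, exp (-(c * (2 / π) ^ 2) * x ^ 2) := by
        rw [intervalIntegral.integral_of_le hle]
        exact MeasureTheory.setIntegral_le_integral (integrable_exp_neg_mul_sq hb)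
          (Eventually.of_forall fun x => (exp_pos _).le)
    _ = √(π / (c * (2 / π) ^ 2)) := integral_gaussian _

lemma integral_exp_neg_mul_cos_sq_le {c : ℝ} (hc : 0 < c) :
    ∫ x in (0 : ℝ)..(2 * π), exp (-c * cos x ^ 2) ≤ π * √(π / c) := by
  have hπ := Real.pi_pos
  have hper : Function.Periodic (fun x => exp (-c * cos x ^ 2)) π := by
    intro x
    simp [cos_add_pi]
  have hshift : ∫ x in (0 : ℝ)..π, exp (-c * cos x ^ 2)
      = ∫ x in (-(π / 2))..(π / 2), exp (-c * sin x ^ 2) := by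
    have h := intervalIntegral.integral_comp_add_right
      (a := -(π / 2)) (b := π / 2) (fun x => exp (-c * cos x ^ 2)) (π / 2)
    simp only [cos_add_pi_div_two, neg_sq, neg_add_cancel, add_halves] at h
    exact h.symm
  have hsecond : ∫ x in π..(2 * π), exp (-c * cos x ^ 2)
      = ∫ x in (0 : ℝ)..π, exp (-c * cos x ^ 2) := by
    have h := hper.intervalIntegral_add_eq π 0
    rwa [zero_add, ← two_mul] at h
  rw [← intervalIntegral.integral_add_adjacent_intervals (b := π)
    (Continuous.intervalIntegrable (by fun_prop) _ _)
    (Continuous.intervalIntegrable (by fun_prop) _ _), hsecond, hshift]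
  have h := integral_exp_neg_mul_sin_sq_le hc
  have e : √(π / (c * (2 / π) ^ 2)) = π / 2 * √(π / c) := by
    rw [show π / (c * (2 / π) ^ 2) = (π / 2) ^ 2 * (π / c) by field_simp,
      sqrt_mul (by positivity), sqrt_sq (by positivity)]
  linarith

lemma iteratedDeriv_eval (q : Polynomial ℂ) (n : ℕ) :
    iteratedDeriv n (fun w => q.eval w) =
      fun w => ((fun r : Polynomial ℂ => Polynomial.derivative r)^[n] q).eval w := by
  induction n generalizing q with
  | zero => simp
  | succ n ih =>
    rw [iteratedDeriv_succ', Function.iterate_succ_apply, ← ih]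
    congr 1
    ext w
    exact q.deriv

lemma norm_iteratedDeriv_le_circle {f : ℂ → ℂ} (hf : Differentiable ℂ f) (c : ℂ) {R : ℝ}
    (hR : 0 < R) (n : ℕ) :
    ‖iteratedDeriv n f c‖ ≤ n.factorial *
      (((2 * π)⁻¹ * ∫ θ : ℝ in 0..2 * π, ‖f (circleMap c R θ)‖) * R⁻¹ ^ n) := by
  lift R to NNReal using hR.le
  have hs := hf.differentiableOn.hasFPowerSeriesOnBall (c := c) (R := R) (by exact_mod_cast hR)
  have h1 := hs.factorial_smul 1 n
  rw [iteratedDeriv_eq_iteratedFDeriv, ← h1, nsmul_eq_mul, norm_mul, Complex.norm_natCast]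
  gcongr
  have h2 := norm_cauchyPowerSeries_le f c R n
  rw [abs_of_pos hR] at h2
  refine le_trans ?_ h2
  refine ((cauchyPowerSeries f c R n).le_opNorm _).trans ?_
  simp

lemma legendreP_eval_ofReal (n : ℕ) (z : ℝ) :
    (((legendreP n).eval z : ℝ) : ℂ) = ((2 ^ n * n.factorial : ℝ) : ℂ)⁻¹ *
      iteratedDeriv n (fun w : ℂ => (w ^ 2 - 1) ^ n) z := by
  have hq : (fun w : ℂ => (w ^ 2 - 1) ^ n) =
      fun w => (((Polynomial.X ^ 2 - 1) ^ n : Polynomial ℝ).map Complex.ofRealHom).eval w := by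
    ext w
    simp
  rw [hq, iteratedDeriv_eval]
  have hmap : ∀ q : Polynomial ℝ,
      (fun r : Polynomial ℂ => Polynomial.derivative r)^[n] (q.map Complex.ofRealHom) =
      ((fun r : Polynomial ℝ => Polynomial.derivative r)^[n] q).map Complex.ofRealHom := by
    intro q
    exact (Polynomial.iterate_derivative_map q Complex.ofRealHom n)
  rw [hmap, legendreP, Polynomial.eval_smul, smul_eq_mul, Complex.ofReal_mul, Complex.ofReal_inv]
  congr 1
  exact (Polynomial.eval_map_apply (p := _) (f := Complex.ofRealHom) z).symm

lemma norm_circleMap_sq_sub_one_le {z : ℝ} (hz : z ∈ Set.Ioo (-1 : ℝ) 1) (θ : ℝ) :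
    ‖(circleMap (z : ℂ) √(1 - z ^ 2) θ) ^ 2 - 1‖ ≤
      2 * √(1 - z ^ 2) * exp (-((1 - z ^ 2) / 2) * cos θ ^ 2) := by
  have ha : 0 < 1 - z ^ 2 := by nlinarith [hz.1, hz.2]
  have hR2 : √(1 - z ^ 2) ^ 2 = 1 - z ^ 2 := sq_sqrt ha.le
  set R := √(1 - z ^ 2) with hR
  have hR0 : 0 ≤ R := sqrt_nonneg _
  refine (pow_le_pow_iff_left₀ (norm_nonneg _) (by positivity) two_ne_zero).1 ?_
  have hsq : ‖(circleMap (z : ℂ) R θ) ^ 2 - 1‖ ^ 2 = 4 * R ^ 2 * (1 - R ^ 2 * cos θ ^ 2) := by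
    have hcm : circleMap (z : ℂ) R θ =
        ((z + R * cos θ : ℝ) : ℂ) + ((R * sin θ : ℝ) : ℂ) * Complex.I := by
      rw [circleMap, Complex.exp_mul_I]
      push_cast
      ring
    have hexp : ∀ x y : ℝ, ‖((x : ℂ) + (y : ℂ) * Complex.I) ^ 2 - 1‖ ^ 2 =
        (x ^ 2 + y ^ 2 + 1) ^ 2 - 4 * x ^ 2 := by
      intro x y
      rw [Complex.sq_norm, Complex.normSq_apply]
      simp [pow_two]
      ring
    have hxy : (z + R * cos θ) ^ 2 + (R * sin θ) ^ 2 + 1 = 2 + 2 * z * R * cos θ := by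
      linear_combination R ^ 2 * sin_sq_add_cos_sq θ + hR2
    rw [hcm, hexp, hxy]
    linear_combination (4 * R ^ 2 * cos θ ^ 2 - 4) * hR2
  rw [hsq, mul_pow, mul_pow, ← exp_nat_mul, hR2]
  have h := add_one_le_exp (-((1 - z ^ 2) * cos θ ^ 2))
  have e : ((2 : ℕ) : ℝ) * (-((1 - z ^ 2) / 2) * cos θ ^ 2) = -((1 - z ^ 2) * cos θ ^ 2) := by
    push_cast; ring
  rw [e]
  nlinarith

lemma abs_eval_legendreP_le {z : ℝ} (hz : z ∈ Set.Ioo (-1 : ℝ) 1) {n : ℕ} (hn : 1 ≤ n) :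
    |(legendreP n).eval z| ≤ √(2 * π / (1 - z ^ 2)) / 2 * (n : ℝ) ^ (-(1 / 2) : ℝ) := by
  have hπ := Real.pi_pos
  have ha : 0 < 1 - z ^ 2 := by nlinarith [hz.1, hz.2]
  have hn0 : (0 : ℝ) < n := by exact_mod_cast hn
  have hR : 0 < √(1 - z ^ 2) := sqrt_pos.2 ha
  have hint : ∫ θ : ℝ in 0..2 * π, ‖((circleMap (z : ℂ) √(1 - z ^ 2) θ) ^ 2 - 1) ^ n‖ ≤
      (2 * √(1 - z ^ 2)) ^ n * (π * √(π / (n * ((1 - z ^ 2) / 2)))) := by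
    calc _ ≤ ∫ θ : ℝ in 0..2 * π, (2 * √(1 - z ^ 2)) ^ n *
            exp (-(n * ((1 - z ^ 2) / 2)) * cos θ ^ 2) := by
          apply intervalIntegral.integral_mono_on (by positivity)
          · exact Continuous.intervalIntegrable (by fun_prop) _ _
          · exact Continuous.intervalIntegrable (by fun_prop) _ _
          · intro θ _
            rw [norm_pow]
            refine (pow_le_pow_left₀ (norm_nonneg _) (norm_circleMap_sq_sub_one_le hz θ) n).trans
              (le_of_eq ?_)
            rw [mul_pow, ← exp_nat_mul]
            congr 2
            ring
      _ ≤ _ := by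
          rw [intervalIntegral.integral_const_mul]
          gcongr
          exact integral_exp_neg_mul_cos_sq_le (by positivity)
  have hcauchy := norm_iteratedDeriv_le_circle (f := fun w : ℂ => (w ^ 2 - 1) ^ n)
    (by fun_prop) z hR n
  have hnorm : |(legendreP n).eval z| = (2 ^ n * n.factorial : ℝ)⁻¹ *
      ‖iteratedDeriv n (fun w : ℂ => (w ^ 2 - 1) ^ n) z‖ := by
    rw [← Real.norm_eq_abs, ← Complex.norm_real, legendreP_eval_ofReal, norm_mul, norm_inv,
      Complex.norm_of_nonneg (by positivity)]
  have hsqrt : √(π / (n * ((1 - z ^ 2) / 2))) =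
      √(2 * π / (1 - z ^ 2)) * (n : ℝ) ^ (-(1 / 2) : ℝ) := by
    rw [rpow_neg hn0.le, ← sqrt_eq_rpow, ← sqrt_inv, ← sqrt_mul (by positivity)]
    congr 1
    field_simp
  rw [hnorm]
  calc _ ≤ (2 ^ n * n.factorial : ℝ)⁻¹ * (n.factorial * (((2 * π)⁻¹ *
        ((2 * √(1 - z ^ 2)) ^ n * (π * √(π / (n * ((1 - z ^ 2) / 2)))))) *
          (√(1 - z ^ 2))⁻¹ ^ n)) := by
        refine mul_le_mul_of_nonneg_left (hcauchy.trans ?_) (by positivity)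
        gcongr
    _ = _ := by
        have hf : (n.factorial : ℝ) ≠ 0 := by positivity
        rw [hsqrt, mul_pow, inv_pow]
        field_simp

lemma sum_rpow_neg_tail_le {s : ℝ} (hs : 1 < s) {L : ℕ} (hL : 1 ≤ L) (N : ℕ) :
    ∑ k ∈ range N, ((L + 1 + k : ℕ) : ℝ) ^ (-s) ≤ (L : ℝ) ^ (1 - s) / (s - 1) := by
  have hL0 : (0 : ℝ) < L := by exact_mod_cast hL
  have hanti : AntitoneOn (fun x : ℝ => x ^ (-s)) (Set.Icc (L : ℝ) (L + N)) := by
    intro x hx y _ hxy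
    exact rpow_le_rpow_of_nonpos (hL0.trans_le hx.1) hxy (by linarith)
  have h := hanti.sum_le_integral
  rw [integral_rpow (Or.inr ⟨by linarith, by
    rw [Set.uIcc_of_le (by simp)]; exact fun h => absurd h.1 (not_le.2 hL0)⟩)] at h
  have e : ∑ k ∈ range N, ((L + 1 + k : ℕ) : ℝ) ^ (-s) =
      ∑ i ∈ range N, ((L : ℝ) + ((i + 1 : ℕ) : ℝ)) ^ (-s) := by
    refine sum_congr rfl fun k _ => ?_
    congr 1
    push_cast
    ring
  rw [e]
  refine h.trans ?_
  rw [show -s + 1 = -(s - 1) by ring, show 1 - s = -(s - 1) by ring, div_neg, ← neg_div]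
  have : 0 ≤ ((L : ℝ) + N) ^ (-(s - 1)) := by positivity
  apply div_le_div_of_nonneg_right _ (by linarith)
  linarith

/-- Tail bound with Legendre weights: if `‖φ_ℓ‖ ≤ γ ℓ^{-β}` with `β > 3/2` and
`z ∈ (-1,1)`, then there is `C > 0` (depending on `γ`, `β` and `z`) such that
`∑_{ℓ=L+1}^{∞} (2ℓ+1) ‖φ_ℓ‖ |P_ℓ(z)| ≤ C L^{3/2-β}` for all `L ≥ 1`. -/
theorem tail_norm_legendre_bound (p : ℕ) (hp : 1 ≤ p) (β γ : ℝ) (hβ : 3 / 2 < β)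
    (hγ : 0 < γ) (z : ℝ) (hz : z ∈ Set.Ioo (-1 : ℝ) 1) :
    ∃ C > 0, ∀ φ : ℕ → EuclideanSpace ℝ (Fin p),
      (∀ ℓ : ℕ, 1 ≤ ℓ → ‖φ ℓ‖ ≤ γ * (ℓ : ℝ) ^ (-β)) →
      ∀ L : ℕ, 1 ≤ L →
        ∑' k : ℕ, (2 * ((L + 1 + k : ℕ) : ℝ) + 1) * ‖φ (L + 1 + k)‖ *
            |(legendreP (L + 1 + k)).eval z|
          ≤ C * (L : ℝ) ^ (3 / 2 - β) := by
  have ha : 0 < 1 - z ^ 2 := by nlinarith [hz.1, hz.2]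
  have hπ := Real.pi_pos
  set K := √(2 * π / (1 - z ^ 2)) / 2 with hK
  have hK0 : 0 < K := by positivity
  have hs : 1 < β - 1 / 2 := by linarith
  refine ⟨3 * γ * K / (β - 1 / 2 - 1), div_pos (by positivity) (by linarith), ?_⟩
  intro φ hφ L hL
  refine Real.tsum_le_of_sum_range_le (fun k => by positivity) fun N => ?_
  have hterm : ∀ k ∈ range N, (2 * ((L + 1 + k : ℕ) : ℝ) + 1) * ‖φ (L + 1 + k)‖ *
      |(legendreP (L + 1 + k)).eval z| ≤
      3 * γ * K * ((L + 1 + k : ℕ) : ℝ) ^ (-(β - 1 / 2)) := by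
    intro k _
    have hm : 1 ≤ L + 1 + k := by omega
    generalize L + 1 + k = m at hm ⊢
    have hm1 : (1 : ℝ) ≤ m := by exact_mod_cast hm
    have hm0 : (0 : ℝ) < m := by linarith
    calc _ ≤ (3 * (m : ℝ)) * (γ * (m : ℝ) ^ (-β)) * (K * (m : ℝ) ^ (-(1 / 2) : ℝ)) := by
          gcongr
          · linarith
          · exact hφ m hm
          · exact abs_eval_legendreP_le hz hm
      _ = 3 * γ * K * ((m : ℝ) ^ (1 : ℝ) * (m : ℝ) ^ (-β) * (m : ℝ) ^ (-(1 / 2) : ℝ)) := by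
          rw [rpow_one]; ring
      _ = _ := by
          rw [← rpow_add hm0, ← rpow_add hm0]
          congr 2
          ring
  refine (sum_le_sum hterm).trans ?_
  rw [← mul_sum]
  refine (mul_le_mul_of_nonneg_left (sum_rpow_neg_tail_le hs hL N) (by positivity)).trans
    (le_of_eq ?_)
  rw [show 1 - (β - 1 / 2) = 3 / 2 - β by ring]
  ring
end
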